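/- arXiv:1105.5182 — 5 statements merged into one kernel-verified Lean document; each statement's English description precedes it below -/
import Mathlib

section
/- Let d ≥ 2, let Ω ⊂ ℝ^d be a bounded open set, and assume φ ∈ C₀^∞(Ω) is supported in a ball of radius l > 0 and satisfies ‖∇φ‖_∞ ≤ C l^{−1}. Then for every h > 0, | Tr(φ H_Ω φ)_− − L_d h^{−d} ∫_Ω φ(x)² dx | ≤ C' l^{d−2} h^{−d+2}, where C' depends only on the constant C in the gradient bound. -/
open MeasureTheory Real Metric Set

noncomputable section

abbrev Euc (d : ℕ) := EuclideanSpace ℝ (Fin d)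

/-- Volume of the unit ball in ℝ^d. -/
noncomputable def ballVol (d : ℕ) : ℝ := (volume (Metric.ball (0 : Euc d) 1)).toReal

/-- The semiclassical constant L_d = 2 ω_d / ((d+2)(2π)^d). -/
noncomputable def Lconst (d : ℕ) : ℝ := 2 * ballVol d / ((d + 2) * (2 * π) ^ d)

/-- Smooth real function compactly supported in the open set U. -/
def TestFun {d : ℕ} (U : Set (Euc d)) (v : Euc d → ℝ) : Prop :=
  ContDiff ℝ (⊤ : ℕ∞) v ∧ HasCompactSupport v ∧ tsupport v ⊆ U

/-- `trNeg U h φ` is Tr(φ H_U φ)_-, the sum of absolute values of the negative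
eigenvalues of φ(-h²Δ_U - 1)φ, expressed by the variational principle as the
supremum, over finite L²-orthonormal families of test functions in U, of
Σ_j (∫ φ² v_j² - h² ∫ |∇(φ v_j)|²). -/
noncomputable def trNeg {d : ℕ} (U : Set (Euc d)) (h : ℝ) (φ : Euc d → ℝ) : ℝ :=
  sSup { S : ℝ | ∃ (n : ℕ) (v : Fin n → Euc d → ℝ),
    (∀ i, TestFun U (v i)) ∧
    (∀ i j, (∫ x : Euc d, v i x * v j x) = if i = j then (1:ℝ) else 0) ∧
    S = ∑ j, ((∫ x : Euc d, (φ x)^2 * (v j x)^2)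
          - h^2 * ∫ x : Euc d, ‖gradient (fun y => φ y * v j y) x‖^2) }

/-- Tr(H_Ω)_- for H_Ω = -h²Δ_Ω - 1. -/
noncomputable def trNegH {d : ℕ} (Ω : Set (Euc d)) (h : ℝ) : ℝ :=
  trNeg Ω h (fun _ => 1)

/-- d(u): the distance from u to the complement of Ω. -/
noncomputable def distOut {d : ℕ} (Ω : Set (Euc d)) (u : Euc d) : ℝ :=
  Metric.infDist u Ωᶜ

/-- The local length scale l(u) = ½(1 + (d(u)² + l₀²)^{-1/2})⁻¹. -/
noncomputable def lfun {d : ℕ} (Ω : Set (Euc d)) (l₀ : ℝ) (u : Euc d) : ℝ :=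
  (1/2) * (1 + (Real.sqrt ((distOut Ω u)^2 + l₀^2))⁻¹)⁻¹

/-- If `f` is a finite family with Bessel bound `w⁻¹` and `B` is a bilinear form, then
`w * ∑ B (f k) (f k)` is bounded by the trace of `B` over some finite orthonormal family. -/
lemma exists_orthonormal_sum_le {E κ : Type*} [NormedAddCommGroup E] [InnerProductSpace ℝ E]
    [Fintype κ] (w : ℝ) (hw : 0 ≤ w) (f : κ → E)
    (hf : ∀ v, w * ∑ k, (inner ℝ (f k) v) ^ 2 ≤ ‖v‖ ^ 2) (B : E →ₗ[ℝ] E →ₗ[ℝ] ℝ) :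
    ∃ (n : ℕ) (u : Fin n → E), Orthonormal ℝ u ∧
      w * ∑ k, B (f k) (f k) ≤ ∑ j, B (u j) (u j) := by
  let V := Submodule.span ℝ (range f)
  have hfin : FiniteDimensional ℝ V := FiniteDimensional.span_of_finite ℝ (finite_range f)
  let g : κ → V := fun k => ⟨f k, Submodule.subset_span (mem_range_self k)⟩
  let T : V →ₗ[ℝ] V := w • ∑ k, (innerₛₗ ℝ (g k)).smulRight (g k)
  have hTapp : ∀ x, T x = w • ∑ k, (inner ℝ (g k) x) • g k := fun x => by
    simp [T, LinearMap.sum_apply]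
  have hTin : ∀ x y, inner ℝ (T x) y = w * ∑ k, inner ℝ (g k) x * inner ℝ (g k) y := fun x y => by
    simp [hTapp, sum_inner, inner_smul_left]
  have hT : T.IsSymmetric := fun x y => by
    rw [hTin, real_inner_comm, hTin]
    simp_rw [mul_comm]
  let b := hT.eigenvectorBasis rfl
  let lam := hT.eigenvalues rfl
  have hb : ∀ i j, w * ∑ k, inner ℝ (g k) (b i) * inner ℝ (g k) (b j)
      = if i = j then lam i else 0 := fun i j => by
    rw [← hTin, hT.apply_eigenvectorBasis rfl i, inner_smul_left,
      orthonormal_iff_ite.1 b.orthonormal i j]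
    simp [lam]
  have hlam0 : ∀ i, 0 ≤ lam i := fun i => by
    have := hb i i
    rw [if_pos rfl] at this
    rw [← this]
    exact mul_nonneg hw (Finset.sum_nonneg fun k _ => mul_self_nonneg _)
  have hlam1 : ∀ i, lam i ≤ 1 := fun i => by
    have h1 := hb i i
    rw [if_pos rfl] at h1
    have h2 := hf (b i : E)
    have h3 : ‖(b i : E)‖ = 1 := b.orthonormal.1 i
    rw [h3] at h2
    rw [← h1]
    simpa [sq, g] using h2
  have hexp : ∀ k, f k = ∑ i, (inner ℝ (g k) (b i)) • (b i : E) := fun k => by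
    have := congrArg (Subtype.val) (b.sum_repr' (g k))
    simp only [Submodule.coe_sum, Submodule.coe_smul] at this
    exact this.symm.trans (Finset.sum_congr rfl fun i _ => by rw [real_inner_comm])
  have key : w * ∑ k, B (f k) (f k) = ∑ i, lam i * B (b i) (b i) := by
    have h1 : ∀ k, B (f k) (f k) = ∑ i, ∑ j, inner ℝ (g k) (b i) * inner ℝ (g k) (b j)
        * B (b i) (b j) := fun k => by
      conv_lhs => rw [hexp k]
      simp only [map_sum, map_smul, LinearMap.sum_apply, LinearMap.smul_apply, smul_eq_mul,
        Finset.mul_sum]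
      rw [Finset.sum_comm]
      refine Finset.sum_congr rfl fun i _ => Finset.sum_congr rfl fun j _ => by ring
    simp_rw [h1]
    rw [Finset.sum_comm, Finset.mul_sum]
    refine Finset.sum_congr rfl fun i _ => ?_
    rw [Finset.sum_comm, Finset.mul_sum]
    have h2 : ∀ j, w * ∑ k, inner ℝ (g k) (b i) * inner ℝ (g k) (b j) * B (b i) (b j)
        = (if i = j then lam i else 0) * B (b i) (b j) := fun j => by
      rw [← hb i j, mul_assoc, Finset.sum_mul]
    simp_rw [h2]
    simp
  let P := {i // 0 ≤ B (b i) (b i)}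
  let e : Fin (Fintype.card P) ≃ P := (Fintype.equivFin P).symm
  refine ⟨Fintype.card P, fun j => (b (e j).1 : E), ?_, ?_⟩
  · exact (b.orthonormal.comp_linearIsometry V.subtypeₗᵢ).comp _
      (Subtype.val_injective.comp e.injective)
  · rw [key, e.sum_comp (fun p : P => B (b p.1) (b p.1))]
    calc ∑ i, lam i * B (b i) (b i)
        ≤ ∑ i, if 0 ≤ B (b i) (b i) then B (b i : E) (b i) else 0 := by
          refine Finset.sum_le_sum fun i _ => ?_
          split_ifs with h
          · exact mul_le_of_le_one_left h (hlam1 i)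
          · exact mul_nonpos_of_nonneg_of_nonpos (hlam0 i) (not_le.1 h).le
      _ = ∑ p : P, B (b p.1 : E) (b p.1) := by
          rw [← Finset.sum_filter]
          exact Finset.sum_subtype _ (by simp) _
      _ ≤ _ := le_rfl

section TestFunctions

variable {d : ℕ} {U : Set (Euc d)} {v w g : Euc d → ℝ}

lemma TestFun.continuous (hv : TestFun U v) : Continuous v := hv.1.continuous

lemma TestFun.differentiable (hv : TestFun U v) : Differentiable ℝ v :=
  hv.1.differentiable (by simp)

lemma TestFun.integrable (hv : TestFun U v) : Integrable v :=
  hv.continuous.integrable_of_hasCompactSupport hv.2.1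

lemma TestFun.mul_right (hv : TestFun U v) (hg : ContDiff ℝ (⊤ : ℕ∞) g) :
    TestFun U (fun x => v x * g x) :=
  ⟨hv.1.mul hg, hv.2.1.mul_right, (tsupport_mul_subset_left).trans hv.2.2⟩

lemma TestFun.mul_left (hv : TestFun U v) (hg : ContDiff ℝ (⊤ : ℕ∞) g) :
    TestFun U (fun x => g x * v x) := by
  simpa only [mul_comm] using hv.mul_right hg

lemma TestFun.integrable_mul (hv : TestFun U v) (hw : TestFun U w) :
    Integrable (fun x => v x * w x) := (hv.mul_right hw.1).integrable

lemma TestFun.integrable_sq (hv : TestFun U v) : Integrable (fun x => v x ^ 2) := by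
  simpa only [sq] using hv.integrable_mul hv

lemma TestFun.add (hv : TestFun U v) (hw : TestFun U w) : TestFun U (v + w) :=
  ⟨hv.1.add hw.1, hv.2.1.add hw.2.1,
    (tsupport_add v w).trans (union_subset hv.2.2 hw.2.2)⟩

lemma TestFun.const_smul (c : ℝ) (hv : TestFun U v) : TestFun U (c • v) :=
  hv.mul_left (g := fun _ => c) contDiff_const

lemma TestFun.continuous_gradient (hv : TestFun U v) : Continuous (gradient v) :=
  (InnerProductSpace.toDual ℝ (Euc d)).symm.continuous.comp (hv.1.continuous_fderiv (by simp))

lemma tsupport_gradient_subset (v : Euc d → ℝ) : tsupport (gradient v) ⊆ tsupport v := by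
  refine closure_minimal (fun x hx => support_fderiv_subset ℝ (f := v) ?_) (isClosed_tsupport v)
  contrapose! hx
  simp only [Function.mem_support, not_not] at hx ⊢
  simp [gradient, hx]

lemma TestFun.hasCompactSupport_gradient (hv : TestFun U v) : HasCompactSupport (gradient v) :=
  hv.2.1.of_isClosed_subset (isClosed_tsupport _) (tsupport_gradient_subset v)

lemma TestFun.integrable_inner_gradient (hv : TestFun U v) (hw : TestFun U w) :
    Integrable (fun x => inner ℝ (gradient v x) (gradient w x)) :=
  (hv.continuous_gradient.inner hw.continuous_gradient).integrable_of_hasCompactSupport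
    (hv.hasCompactSupport_gradient.mono fun x hx h0 => hx (by simp [h0]))

lemma TestFun.integrable_sq_norm_gradient (hv : TestFun U v) :
    Integrable (fun x => ‖gradient v x‖ ^ 2) := by
  simpa only [real_inner_self_eq_norm_sq] using hv.integrable_inner_gradient hv

lemma gradient_add_apply {x : Euc d} (hv : DifferentiableAt ℝ v x) (hw : DifferentiableAt ℝ w x) :
    gradient (fun y => v y + w y) x = gradient v x + gradient w x := by
  simp only [gradient]
  rw [fderiv_fun_add hv hw, map_add]

lemma gradient_const_mul_apply {x : Euc d} (c : ℝ) (hv : DifferentiableAt ℝ v x) :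
    gradient (fun y => c * v y) x = c • gradient v x := by
  simp only [gradient]
  rw [fderiv_const_mul hv, map_smul]

variable (U) in
/-- The space of real test functions in `U`, with the `L²` inner product. -/
def testSubmodule : Submodule ℝ (Euc d → ℝ) where
  carrier := {v | TestFun U v}
  add_mem' := TestFun.add
  zero_mem' := ⟨contDiff_const, HasCompactSupport.zero, by simp [tsupport]⟩
  smul_mem' c _ hv := hv.const_smul c

variable (U) in
/-- The test functions in `U`, as a type which carries the `L²` inner product. -/
def TestSpace : Type := testSubmodule U

instance : AddCommGroup (TestSpace U) := inferInstanceAs (AddCommGroup (testSubmodule U))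

instance : Module ℝ (TestSpace U) := inferInstanceAs (Module ℝ (testSubmodule U))

instance : CoeFun (TestSpace U) (fun _ => Euc d → ℝ) := ⟨fun v => Subtype.val v⟩

lemma TestSpace.testFun (v : TestSpace U) : TestFun U v := Subtype.property v

lemma TestSpace.add_apply (v w : TestSpace U) (x : Euc d) : (v + w) x = v x + w x := rfl

lemma TestSpace.smul_apply (c : ℝ) (v : TestSpace U) (x : Euc d) : (c • v) x = c * v x := rfl

variable (U) in
/-- The `L²` inner product on test functions. -/
@[reducible]
def testSpaceCore : InnerProductSpace.Core ℝ (TestSpace U) where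
  inner v w := ∫ x, v x * w x
  conj_inner_symm v w := by simp [mul_comm]
  re_inner_nonneg v := integral_nonneg fun x => mul_self_nonneg _
  add_left u v w := by
    simp only [TestSpace.add_apply, add_mul]
    exact integral_add (u.testFun.integrable_mul w.testFun) (v.testFun.integrable_mul w.testFun)
  smul_left v w c := by
    simp only [TestSpace.smul_apply, mul_assoc]
    exact integral_const_mul _ _
  definite v hv := by
    have h1 := (integral_eq_zero_iff_of_nonneg (fun x => mul_self_nonneg (v x))
      (v.testFun.integrable_mul v.testFun)).1 hv
    have h2 := (Continuous.ae_eq_iff_eq volume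
      (v.testFun.continuous.mul v.testFun.continuous) continuous_zero).1 h1
    refine Subtype.ext (funext fun x => ?_)
    exact mul_self_eq_zero.1 (congrFun h2 x)

instance : NormedAddCommGroup (TestSpace U) := (testSpaceCore U).toNormedAddCommGroup

instance : InnerProductSpace ℝ (TestSpace U) := InnerProductSpace.ofCore (testSpaceCore U).toCore

lemma TestSpace.inner_def (v w : TestSpace U) : inner ℝ v w = ∫ x, v x * w x := rfl

lemma TestSpace.norm_sq (v : TestSpace U) : ‖v‖ ^ 2 = ∫ x, v x ^ 2 := by
  rw [← real_inner_self_eq_norm_sq, TestSpace.inner_def]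
  simp only [sq]

/-- The quadratic form of `-φ H φ`, polarised. -/
def negForm (h : ℝ) {φ : Euc d → ℝ} (hφ : ContDiff ℝ (⊤ : ℕ∞) φ) :
    TestSpace U →ₗ[ℝ] TestSpace U →ₗ[ℝ] ℝ :=
  LinearMap.mk₂ ℝ
    (fun v w => (∫ x, (φ x * v x) * (φ x * w x))
      - h ^ 2 * ∫ x, inner ℝ (gradient (fun y => φ y * v y) x) (gradient (fun y => φ y * w y) x))
    (fun u v w => by
      have hu := u.testFun.mul_left hφ
      have hv := v.testFun.mul_left hφ
      have hw := w.testFun.mul_left hφ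
      simp only [TestSpace.add_apply, mul_add,
        gradient_add_apply hu.differentiable.differentiableAt hv.differentiable.differentiableAt,
        inner_add_left, add_mul]
      rw [integral_add (hu.integrable_mul hw) (hv.integrable_mul hw),
        integral_add (hu.integrable_inner_gradient hw) (hv.integrable_inner_gradient hw)]
      ring)
    (fun c v w => by
      have hv := v.testFun.mul_left hφ
      simp only [TestSpace.smul_apply, mul_left_comm _ c,
        gradient_const_mul_apply c hv.differentiable.differentiableAt, real_inner_smul_left,
        mul_assoc]
      rw [integral_const_mul, integral_const_mul, smul_eq_mul]
      ring)
    (fun w u v => by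
      have hu := u.testFun.mul_left hφ
      have hv := v.testFun.mul_left hφ
      have hw := w.testFun.mul_left hφ
      simp only [TestSpace.add_apply, mul_add,
        gradient_add_apply hu.differentiable.differentiableAt hv.differentiable.differentiableAt,
        inner_add_right]
      rw [integral_add (hw.integrable_mul hu) (hw.integrable_mul hv),
        integral_add (hw.integrable_inner_gradient hu) (hw.integrable_inner_gradient hv)]
      ring)
    (fun c w v => by
      have hv := v.testFun.mul_left hφ
      simp only [TestSpace.smul_apply, mul_left_comm _ c,
        gradient_const_mul_apply c hv.differentiable.differentiableAt, real_inner_smul_right]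
      rw [integral_const_mul, integral_const_mul, smul_eq_mul]
      ring)

lemma negForm_apply_self (h : ℝ) {φ : Euc d → ℝ} (hφ : ContDiff ℝ (⊤ : ℕ∞) φ) (v : TestSpace U) :
    negForm h hφ v v = (∫ x, φ x ^ 2 * v x ^ 2)
      - h ^ 2 * ∫ x, ‖gradient (fun y => φ y * v y) x‖ ^ 2 := by
  simp only [negForm, LinearMap.mk₂_apply, real_inner_self_eq_norm_sq, ← sq, mul_pow]

end TestFunctions

section Torus

/-- The Haar probability measure on the circle, as in `UnitAddTorus`. -/
local instance : MeasureSpace UnitAddCircle := ⟨AddCircle.haarAddCircle⟩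

local instance : IsProbabilityMeasure (volume : Measure UnitAddCircle) :=
  inferInstanceAs (IsProbabilityMeasure AddCircle.haarAddCircle)

lemma mFourier_neg_coe {ι : Type*} [Fintype ι] (k : ι → ℤ) (x : ι → ℝ) :
    UnitAddTorus.mFourier (-k) (fun i => (x i : UnitAddCircle))
      = Complex.exp (-((2 * π * ∑ i, k i * x i : ℝ) : ℂ) * Complex.I) := by
  simp only [UnitAddTorus.mFourier, ContinuousMap.coe_mk, fourier_coe_apply, ← Complex.exp_sum]
  congr 1
  push_cast
  rw [Finset.mul_sum, ← Finset.sum_neg_distrib, Finset.sum_mul]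
  refine Finset.sum_congr rfl fun i _ => ?_
  simp
  ring

lemma sq_norm_integral_mul_exp {α : Type*} [MeasurableSpace α] {μ : Measure α} (w θ : α → ℝ)
    (hw : Integrable w μ) (hθ : AEStronglyMeasurable θ μ) :
    ‖∫ x, Complex.exp (-(θ x : ℂ) * Complex.I) * (w x : ℂ) ∂μ‖ ^ 2
      = (∫ x, w x * cos (θ x) ∂μ) ^ 2 + (∫ x, w x * sin (θ x) ∂μ) ^ 2 := by
  have h1 : Integrable (fun x => w x * cos (θ x)) μ :=
    hw.mul_bdd (c := 1) (continuous_cos.comp_aestronglyMeasurable hθ)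
      (Filter.Eventually.of_forall fun x => abs_cos_le_one _)
  have h2 : Integrable (fun x => w x * sin (θ x)) μ :=
    hw.mul_bdd (c := 1) (continuous_sin.comp_aestronglyMeasurable hθ)
      (Filter.Eventually.of_forall fun x => abs_sin_le_one _)
  have h3 : ∀ x, Complex.exp (-(θ x : ℂ) * Complex.I) * (w x : ℂ)
      = ((w x * cos (θ x) : ℝ) : ℂ) - ((w x * sin (θ x) : ℝ) : ℂ) * Complex.I := fun x => by
    rw [← Complex.ofReal_neg, Complex.exp_mul_I, ← Complex.ofReal_cos, ← Complex.ofReal_sin,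
      cos_neg, sin_neg]
    push_cast
    ring
  simp_rw [h3]
  rw [integral_sub h1.ofReal (h2.ofReal.mul_const _), integral_mul_const, integral_complex_ofReal,
    integral_complex_ofReal, ← Complex.normSq_eq_norm_sq, Complex.normSq_apply]
  simp
  ring

lemma bessel_unit_cube {ι : Type*} [Fintype ι] {w : (ι → ℝ) → ℝ} (hw : Continuous w)
    (hcs : HasCompactSupport w)
    (hsupp : ∀ x, w x ≠ 0 → ∀ i, x i ∈ Ioc (-(1 / 2) : ℝ) (-(1 / 2) + 1))
    (F : Finset (ι → ℤ)) :
    ∑ k ∈ F, ((∫ x, w x * cos (2 * π * ∑ i, k i * x i)) ^ 2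
      + (∫ x, w x * sin (2 * π * ∑ i, k i * x i)) ^ 2) ≤ ∫ x, w x ^ 2 := by
  let a : ι → ℝ := fun _ => -(1 / 2)
  let Q : Set (ι → ℝ) := {x | ∀ i, x i ∈ Ioc (a i) (a i + 1)}
  have hQ : MeasurableSet Q := MeasurableSet.univ_pi' fun i => measurableSet_Ioc
  let f : UnitAddTorus ι → ℂ := fun t => (w (UnitAddTorus.measurableEquivPiIoc a t).1 : ℂ)
  have hfQ : ∀ x ∈ Q, f (fun i => (x i : UnitAddCircle)) = (w x : ℂ) := fun x hx => by
    have := (UnitAddTorus.measurableEquivPiIoc a).apply_symm_apply ⟨x, hx⟩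
    rw [UnitAddTorus.coe_symm_measurableEquivPiIoc_apply] at this
    simp only [f, this]
  obtain ⟨c, hc⟩ := hw.bounded_above_of_compact_support hcs
  have hf : MemLp f 2 := by
    refine MemLp.of_bound ?_ c (Filter.Eventually.of_forall fun t => ?_)
    · exact (Complex.measurable_ofReal.comp (hw.measurable.comp (measurable_subtype_coe.comp
        (UnitAddTorus.measurableEquivPiIoc a).measurable))).aestronglyMeasurable
    · simpa [f] using hc _
  have hwi : Integrable w := hw.integrable_of_hasCompactSupport hcs
  have hcoef : ∀ k, ‖UnitAddTorus.mFourierCoeff (hf.toLp f) k‖ ^ 2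
      = (∫ x, w x * cos (2 * π * ∑ i, k i * x i)) ^ 2
        + (∫ x, w x * sin (2 * π * ∑ i, k i * x i)) ^ 2 := fun k => by
    have h1 : UnitAddTorus.mFourierCoeff (hf.toLp f) k = UnitAddTorus.mFourierCoeff f k :=
      integral_congr_ae (by filter_upwards [hf.coeFn_toLp] with t ht; rw [ht])
    have h2 : UnitAddTorus.mFourierCoeff f k
        = ∫ x, Complex.exp (-((2 * π * ∑ i, (k i : ℝ) * x i : ℝ) : ℂ) * Complex.I) * (w x : ℂ) := by
      rw [UnitAddTorus.mFourierCoeff_eq_integral f k a]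
      refine (setIntegral_congr_fun hQ fun x hx => ?_).trans
        (setIntegral_eq_integral_of_forall_compl_eq_zero fun x hx => ?_)
      · simp only [hfQ x hx, mFourier_neg_coe, smul_eq_mul]
      · have : w x = 0 := by
          by_contra h0
          exact hx (hsupp x h0)
        simp [this]
    rw [h1, h2]
    exact sq_norm_integral_mul_exp w _ hwi
      (Continuous.aestronglyMeasurable (by fun_prop))
  have hint : ∫ t, ‖hf.toLp f t‖ ^ 2 = ∫ x, w x ^ 2 := by
    have h1 : ∫ t, ‖hf.toLp f t‖ ^ 2 = ∫ t, ‖f t‖ ^ 2 :=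
      integral_congr_ae (by filter_upwards [hf.coeFn_toLp] with t ht; rw [ht])
    rw [h1, UnitAddTorus.integral_preimage (fun t => ‖f t‖ ^ 2) a]
    refine (setIntegral_congr_fun hQ fun x hx => ?_).trans
      (setIntegral_eq_integral_of_forall_compl_eq_zero fun x hx => ?_)
    · simp [hfQ x hx]
    · have : w x = 0 := by
        by_contra h0
        exact hx (hsupp x h0)
      simp [this]
  have h := UnitAddTorus.hasSum_sq_mFourierCoeff (hf.toLp f)
  rw [hint] at h
  simp_rw [← hcoef]
  exact sum_le_hasSum F (fun _ _ => by positivity) h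

end Torus

lemma integral_euc_eq_smul {d : ℕ} (G : Euc d → ℝ) {c : ℝ} (hc : 0 < c) :
    ∫ y : Fin d → ℝ, G (WithLp.toLp 2 (c • y)) = (c ^ d)⁻¹ * ∫ x, G x := by
  have h1 := Measure.integral_comp_smul (volume : Measure (Fin d → ℝ))
    (fun y => G (WithLp.toLp 2 y)) c
  rw [h1, Module.finrank_fin_fun, abs_of_pos (by positivity), smul_eq_mul]
  congr 1
  exact (PiLp.volume_preserving_toLp (Fin d)).integral_comp
    (MeasurableEquiv.toLp 2 (Fin d → ℝ)).measurableEmbedding G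

lemma TestFun.bessel_lattice {d : ℕ} {U : Set (Euc d)} {v : Euc d → ℝ} (hv : TestFun U v)
    {n : ℕ} (hn : 0 < n) (hU : U ⊆ ball 0 (n / 2)) {κ : Type*} [Fintype κ] {ξ : κ → Euc d}
    {k : κ → Fin d → ℤ} (hk : Function.Injective k) (hξ : ∀ a i, ξ a i = k a i / n) :
    ((n : ℝ) ^ d)⁻¹ * ∑ a, ((∫ x, v x * cos (2 * π * inner ℝ x (ξ a))) ^ 2
      + (∫ x, v x * sin (2 * π * inner ℝ x (ξ a))) ^ 2) ≤ ∫ x, v x ^ 2 := by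
  have hn' : (0 : ℝ) < n := Nat.cast_pos.2 hn
  let w : (Fin d → ℝ) → ℝ := fun y => v (WithLp.toLp 2 ((n : ℝ) • y))
  have hwv : ∀ y, w y = v (WithLp.toLp 2 ((n : ℝ) • y)) := fun y => rfl
  have hw : Continuous w := hv.continuous.comp
    ((PiLp.continuous_toLp 2 _).comp (continuous_const_smul _))
  have hsupp : ∀ y, w y ≠ 0 → ∀ i, |y i| < 1 / 2 := fun y hy i => by
    have h1 := hU (hv.2.2 (subset_tsupport _ hy))
    rw [mem_ball_zero_iff] at h1
    have h2 := (PiLp.norm_apply_le (WithLp.toLp 2 ((n : ℝ) • y) : Euc d) i).trans_lt h1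
    simp only [Pi.smul_apply, smul_eq_mul, norm_mul, Real.norm_eq_abs, Nat.abs_cast] at h2
    have h3 : (n : ℝ) * |y i| < n * (1 / 2) := by linarith
    exact lt_of_mul_lt_mul_left h3 hn'.le
  have hcs : HasCompactSupport w :=
    HasCompactSupport.intro (isCompact_univ_pi fun _ => isCompact_Icc (a := -(1 / 2 : ℝ))
      (b := 1 / 2)) fun y hy => by
      by_contra h0
      exact hy fun i _ => abs_le.1 (hsupp y h0 i).le
  have hB := bessel_unit_cube hw hcs (fun y hy i => by
    have := abs_lt.1 (hsupp y hy i)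
    exact ⟨this.1, by linarith [this.2]⟩) (Finset.univ.map ⟨k, hk⟩)
  rw [Finset.sum_map] at hB
  simp only [Function.Embedding.coeFn_mk] at hB
  have hph : ∀ a (y : Fin d → ℝ), ∑ i, (k a i : ℝ) * y i
      = inner ℝ (WithLp.toLp 2 ((n : ℝ) • y) : Euc d) (ξ a) := fun a y => by
    rw [PiLp.inner_apply]
    refine Finset.sum_congr rfl fun i _ => ?_
    simp only [hξ, Pi.smul_apply, smul_eq_mul, RCLike.inner_apply, conj_trivial]
    field_simp
  simp only [hwv, hph] at hB
  rw [integral_euc_eq_smul (fun x => v x ^ 2) hn'] at hB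
  have hcos : ∀ a, ∫ y : Fin d → ℝ, v (WithLp.toLp 2 ((n : ℝ) • y))
      * cos (2 * π * inner ℝ (WithLp.toLp 2 ((n : ℝ) • y) : Euc d) (ξ a))
      = ((n : ℝ) ^ d)⁻¹ * ∫ x, v x * cos (2 * π * inner ℝ x (ξ a)) := fun a =>
    integral_euc_eq_smul (fun x => v x * cos (2 * π * inner ℝ x (ξ a))) hn'
  have hsin : ∀ a, ∫ y : Fin d → ℝ, v (WithLp.toLp 2 ((n : ℝ) • y))
      * sin (2 * π * inner ℝ (WithLp.toLp 2 ((n : ℝ) • y) : Euc d) (ξ a))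
      = ((n : ℝ) ^ d)⁻¹ * ∫ x, v x * sin (2 * π * inner ℝ x (ξ a)) := fun a =>
    integral_euc_eq_smul (fun x => v x * sin (2 * π * inner ℝ x (ξ a))) hn'
  simp only [hcos, hsin, mul_pow, ← mul_add, ← Finset.mul_sum] at hB
  rw [sq, mul_assoc] at hB
  exact le_of_mul_le_mul_left hB (by positivity)

section Plancherel

open scoped FourierTransform LineDeriv

variable {d : ℕ} {U : Set (Euc d)} {v : Euc d → ℝ}

/-- The squared modulus of the Fourier transform of a real function. -/
def fourierDensity (v : Euc d → ℝ) (ξ : Euc d) : ℝ :=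
  (∫ x, v x * cos (2 * π * inner ℝ x ξ)) ^ 2 + (∫ x, v x * sin (2 * π * inner ℝ x ξ)) ^ 2

lemma fourierDensity_nonneg (v : Euc d → ℝ) (ξ : Euc d) : 0 ≤ fourierDensity v ξ := by
  unfold fourierDensity
  positivity

/-- A test function, as a complex valued Schwartz function. -/
def TestFun.toSchwartz (hv : TestFun U v) : SchwartzMap (Euc d) ℂ :=
  HasCompactSupport.toSchwartzMap (f := fun x => (v x : ℂ))
    (hv.2.1.comp_left (g := Complex.ofReal) Complex.ofReal_zero)
    (Complex.ofRealCLM.contDiff.comp hv.1)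

lemma TestFun.toSchwartz_apply (hv : TestFun U v) (x : Euc d) : hv.toSchwartz x = (v x : ℂ) := rfl

lemma TestFun.sq_norm_fourier (hv : TestFun U v) (ξ : Euc d) :
    ‖𝓕 hv.toSchwartz ξ‖ ^ 2 = fourierDensity v ξ := by
  rw [SchwartzMap.fourier_coe, Real.fourier_eq', fourierDensity, ← sq_norm_integral_mul_exp v
    (fun x => 2 * π * inner ℝ x ξ) hv.integrable (Continuous.aestronglyMeasurable (by fun_prop))]
  congr 2
  refine integral_congr_ae (Filter.Eventually.of_forall fun x => ?_)
  simp [TestFun.toSchwartz_apply]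

lemma TestFun.integral_fourierDensity (hv : TestFun U v) :
    ∫ ξ, fourierDensity v ξ = ∫ x, v x ^ 2 := by
  simp_rw [← hv.sq_norm_fourier]
  rw [SchwartzMap.integral_norm_sq_fourier]
  simp [TestFun.toSchwartz_apply]

lemma SchwartzMap.integrable_sq_norm (f : SchwartzMap (Euc d) ℂ) :
    Integrable (fun x => ‖f x‖ ^ 2) := (f.memLp 2).integrable_norm_pow (by simp)

lemma TestFun.integrable_fourierDensity (hv : TestFun U v) :
    Integrable (fourierDensity v) := by
  refine (SchwartzMap.integrable_sq_norm (𝓕 hv.toSchwartz)).congr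
    (Filter.Eventually.of_forall hv.sq_norm_fourier)

lemma TestFun.sq_norm_fourier_lineDeriv (hv : TestFun U v) (m ξ : Euc d) :
    ‖𝓕 (∂_{m} hv.toSchwartz) ξ‖ ^ 2 = (2 * π) ^ 2 * (inner ℝ ξ m) ^ 2 * fourierDensity v ξ := by
  rw [← hv.sq_norm_fourier, SchwartzMap.fourier_lineDerivOp_eq, smul_apply,
    SchwartzMap.smulLeftCLM_apply_apply
      (show (fun x : Euc d => inner ℝ x m).HasTemperateGrowth from
        ((innerSL ℝ).flip m).hasTemperateGrowth)]
  simp [mul_pow, mul_assoc]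

lemma TestFun.sq_norm_lineDeriv (hv : TestFun U v) (m x : Euc d) :
    ‖(∂_{m} hv.toSchwartz) x‖ ^ 2 = (inner ℝ (gradient v x) m) ^ 2 := by
  have h1 : HasFDerivAt (fun x => (v x : ℂ)) (Complex.ofRealCLM.comp (fderiv ℝ v x)) x :=
    Complex.ofRealCLM.hasFDerivAt.comp x hv.differentiable.differentiableAt.hasFDerivAt
  have h2 : (∂_{m} hv.toSchwartz) x = ((fderiv ℝ v x m : ℝ) : ℂ) := by
    rw [SchwartzMap.lineDerivOp_apply_eq_fderiv]
    change fderiv ℝ (fun x => (v x : ℂ)) x m = _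
    rw [h1.fderiv]
    rfl
  rw [h2]
  simp [gradient]

lemma sum_sq_inner_basis (y : Euc d) :
    ∑ i, (inner ℝ y (EuclideanSpace.basisFun (Fin d) ℝ i)) ^ 2 = ‖y‖ ^ 2 := by
  rw [EuclideanSpace.norm_sq_eq]
  simp [EuclideanSpace.basisFun_apply, EuclideanSpace.inner_single_right]

lemma TestFun.integrable_sq_norm_mul_fourierDensity (hv : TestFun U v) :
    Integrable (fun ξ => (2 * π) ^ 2 * ‖ξ‖ ^ 2 * fourierDensity v ξ) := by
  simp_rw [← sum_sq_inner_basis, Finset.mul_sum, Finset.sum_mul]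
  refine integrable_finsetSum _ fun i _ => ?_
  simp_rw [← hv.sq_norm_fourier_lineDeriv]
  exact SchwartzMap.integrable_sq_norm _

lemma TestFun.integral_sq_norm_gradient (hv : TestFun U v) :
    ∫ x, ‖gradient v x‖ ^ 2 = ∫ ξ, (2 * π) ^ 2 * ‖ξ‖ ^ 2 * fourierDensity v ξ := by
  simp_rw [← sum_sq_inner_basis, Finset.mul_sum, Finset.sum_mul, ← hv.sq_norm_fourier_lineDeriv,
    ← hv.sq_norm_lineDeriv]
  rw [integral_finsetSum _ fun i _ => SchwartzMap.integrable_sq_norm _,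
    integral_finsetSum _ fun i _ => SchwartzMap.integrable_sq_norm _]
  simp_rw [SchwartzMap.integral_norm_sq_fourier]

end Plancherel

lemma sum_inner_sq_le_norm_sq {E : Type*} [NormedAddCommGroup E] [InnerProductSpace ℝ E] {n : ℕ}
    {u : Fin n → E} (hu : Orthonormal ℝ u) (x : E) : ∑ j, (inner ℝ (u j) x) ^ 2 ≤ ‖x‖ ^ 2 := by
  simpa using hu.sum_inner_products_le (s := Finset.univ) x

section UpperBound

variable {d : ℕ} {U : Set (Euc d)} {φ : Euc d → ℝ}

lemma contDiff_cos_phase (ξ : Euc d) :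
    ContDiff ℝ (⊤ : ℕ∞) (fun x : Euc d => cos (2 * π * inner ℝ x ξ)) :=
  (contDiff_const.mul (contDiff_id.inner ℝ contDiff_const)).cos

lemma contDiff_sin_phase (ξ : Euc d) :
    ContDiff ℝ (⊤ : ℕ∞) (fun x : Euc d => sin (2 * π * inner ℝ x ξ)) :=
  (contDiff_const.mul (contDiff_id.inner ℝ contDiff_const)).sin

lemma integral_mul_cos_sq_add_mul_sin_sq {χ : Euc d → ℝ} (hχ : TestFun U χ) (ξ : Euc d) :
    (∫ x, (χ x * cos (2 * π * inner ℝ x ξ)) ^ 2) + ∫ x, (χ x * sin (2 * π * inner ℝ x ξ)) ^ 2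
      = ∫ x, χ x ^ 2 := by
  rw [← integral_add (hχ.mul_right (contDiff_cos_phase ξ)).integrable_sq
    (hχ.mul_right (contDiff_sin_phase ξ)).integrable_sq]
  refine integral_congr_ae (Filter.Eventually.of_forall fun x => ?_)
  simp only [mul_pow, ← mul_add, cos_sq_add_sin_sq, mul_one]

lemma sum_fourierDensity_le (hφ : TestFun U φ) {n : ℕ} {u : Fin n → TestSpace U}
    (hu : Orthonormal ℝ u) (ξ : Euc d) :
    ∑ j, fourierDensity (fun x => φ x * u j x) ξ ≤ ∫ x, φ x ^ 2 := by
  let c : TestSpace U := ⟨_, hφ.mul_right (contDiff_cos_phase ξ)⟩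
  let s : TestSpace U := ⟨_, hφ.mul_right (contDiff_sin_phase ξ)⟩
  have h := add_le_add (sum_inner_sq_le_norm_sq hu c) (sum_inner_sq_le_norm_sq hu s)
  rw [TestSpace.norm_sq, TestSpace.norm_sq, ← Finset.sum_add_distrib] at h
  refine le_trans (le_of_eq ?_) (h.trans_eq (integral_mul_cos_sq_add_mul_sin_sq hφ ξ))
  refine Finset.sum_congr rfl fun j _ => ?_
  have hc : inner ℝ (u j) c = ∫ x, φ x * u j x * cos (2 * π * inner ℝ x ξ) :=
    integral_congr_ae (Filter.Eventually.of_forall fun x => by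
      change u j x * (φ x * cos (2 * π * inner ℝ x ξ)) = φ x * u j x * cos (2 * π * inner ℝ x ξ)
      ring)
  have hs : inner ℝ (u j) s = ∫ x, φ x * u j x * sin (2 * π * inner ℝ x ξ) :=
    integral_congr_ae (Filter.Eventually.of_forall fun x => by
      change u j x * (φ x * sin (2 * π * inner ℝ x ξ)) = φ x * u j x * sin (2 * π * inner ℝ x ξ)
      ring)
  rw [hc, hs, fourierDensity]

/-- The Weyl symbol `1 - (2πh)²|ξ|²`. -/
def symbol (h : ℝ) (ξ : Euc d) : ℝ := 1 - (2 * π * h) ^ 2 * ‖ξ‖ ^ 2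

lemma continuous_symbol (h : ℝ) : Continuous (symbol h : Euc d → ℝ) := by
  unfold symbol
  fun_prop

lemma TestFun.integrable_symbol_mul {v : Euc d → ℝ} (hv : TestFun U v) (h : ℝ) :
    Integrable (fun ξ => symbol h ξ * fourierDensity v ξ) := by
  refine (hv.integrable_fourierDensity.sub
    (hv.integrable_sq_norm_mul_fourierDensity.const_mul (h ^ 2))).congr
    (Filter.Eventually.of_forall fun ξ => ?_)
  simp only [symbol, Pi.sub_apply]
  ring

lemma TestFun.integral_symbol_mul {v : Euc d → ℝ} (hv : TestFun U v) (h : ℝ) :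
    (∫ x, v x ^ 2) - h ^ 2 * ∫ x, ‖gradient v x‖ ^ 2
      = ∫ ξ, symbol h ξ * fourierDensity v ξ := by
  rw [← hv.integral_fourierDensity, hv.integral_sq_norm_gradient, ← integral_const_mul,
    ← integral_sub hv.integrable_fourierDensity
      (hv.integrable_sq_norm_mul_fourierDensity.const_mul (h ^ 2))]
  refine integral_congr_ae (Filter.Eventually.of_forall fun ξ => ?_)
  simp only [symbol]
  ring

lemma symbol_nonneg_iff {h : ℝ} (hh : 0 < h) (ξ : Euc d) :
    ξ ∈ closedBall (0 : Euc d) (2 * π * h)⁻¹ ↔ 0 ≤ symbol h ξ := by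
  rw [mem_closedBall_zero_iff, symbol, sub_nonneg, ← mul_pow,
    sq_le_one_iff₀ (by positivity), ← one_div, le_div_iff₀' (by positivity)]

lemma sum_negForm_le (hφ : TestFun U φ) {h : ℝ} (hh : 0 < h) {n : ℕ} {u : Fin n → TestSpace U}
    (hu : Orthonormal ℝ u) :
    ∑ j, negForm h hφ.1 (u j) (u j)
      ≤ (∫ ξ in closedBall (0 : Euc d) (2 * π * h)⁻¹, symbol h ξ) * ∫ x, φ x ^ 2 := by
  have hv : ∀ j, TestFun U (fun x => φ x * u j x) := fun j => (u j).testFun.mul_left hφ.1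
  have h1 : ∑ j, negForm h hφ.1 (u j) (u j)
      = ∫ ξ, symbol h ξ * ∑ j, fourierDensity (fun x => φ x * u j x) ξ := by
    simp_rw [Finset.mul_sum]
    rw [integral_finsetSum _ fun j _ => (hv j).integrable_symbol_mul h]
    refine Finset.sum_congr rfl fun j _ => ?_
    rw [negForm_apply_self, ← (hv j).integral_symbol_mul]
    simp only [mul_pow]
  rw [h1, ← integral_mul_const, ← integral_indicator isClosed_closedBall.measurableSet]
  refine integral_mono ?_ ?_ fun ξ => ?_
  · simp_rw [Finset.mul_sum]
    exact integrable_finsetSum _ fun j _ => (hv j).integrable_symbol_mul h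
  · rw [integrable_indicator_iff isClosed_closedBall.measurableSet]
    exact ((continuous_symbol h).mul continuous_const).continuousOn.integrableOn_compact
      (isCompact_closedBall _ _)
  · have h0 : 0 ≤ ∑ j, fourierDensity (fun x => φ x * u j x) ξ :=
      Finset.sum_nonneg fun j _ => fourierDensity_nonneg _ _
    by_cases hξ : ξ ∈ closedBall (0 : Euc d) (2 * π * h)⁻¹
    · rw [indicator_of_mem hξ]
      exact mul_le_mul_of_nonneg_left (sum_fourierDensity_le hφ hu ξ)
        ((symbol_nonneg_iff hh ξ).1 hξ)
    · rw [indicator_of_notMem hξ]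
      rw [symbol_nonneg_iff hh, not_le] at hξ
      exact mul_nonpos_of_nonpos_of_nonneg hξ.le h0

end UpperBound

section LowerBound

open Filter Topology
open scoped Pointwise Manifold

variable {d : ℕ} {U : Set (Euc d)} {φ χ : Euc d → ℝ}

lemma exists_testFun_cutoff (hU : IsOpen U) (hφ : TestFun U φ) :
    ∃ χ, TestFun U χ ∧ (∀ x, χ x ^ 2 ≤ 1) ∧ ∀ x, φ x * χ x = φ x := by
  obtain ⟨K, hK, hφK, hKU⟩ := exists_compact_between hφ.2.1 hU hφ.2.2
  obtain ⟨f, h1, h0, h01⟩ := exists_contMDiffMap_one_nhds_of_subset_interior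
    (𝓘(ℝ, Euc d)) (n := (⊤ : ℕ∞)) (isClosed_tsupport φ) hφK
  have hsupp : tsupport f ⊆ K := closure_minimal
    (fun x hx => by_contra fun hxK => hx (h0 x hxK)) hK.isClosed
  refine ⟨f, ⟨f.contMDiff.contDiff, hK.of_isClosed_subset (isClosed_tsupport _) hsupp,
    hsupp.trans hKU⟩, fun x => pow_le_one₀ (h01 x).1 (h01 x).2, fun x => ?_⟩
  by_cases hx : x ∈ tsupport φ
  · rw [h1.self_of_nhdsSet x hx, mul_one]
  · rw [image_eq_zero_of_notMem_tsupport hx, zero_mul]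

lemma hasGradientAt_phase (ξ x : Euc d) :
    HasGradientAt (fun y : Euc d => 2 * π * inner ℝ y ξ) ((2 * π) • ξ) x := by
  rw [hasGradientAt_iff_hasFDerivAt]
  have h := (((innerSL ℝ ξ).hasFDerivAt (x := x)).const_mul (2 * π))
  refine (h.congr_of_eventuallyEq (Eventually.of_forall fun y => ?_)).congr_fderiv ?_
  · simp [real_inner_comm]
  · ext y
    simp

lemma gradient_mul_cos_phase (hφ : TestFun U φ) (ξ x : Euc d) :
    gradient (fun y => φ y * cos (2 * π * inner ℝ y ξ)) x
      = cos (2 * π * inner ℝ x ξ) • gradient φ x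
        - (φ x * sin (2 * π * inner ℝ x ξ)) • (2 * π) • ξ := by
  refine HasGradientAt.gradient ?_
  rw [hasGradientAt_iff_hasFDerivAt]
  have h1 := hφ.differentiable.differentiableAt (x := x) |>.hasGradientAt.hasFDerivAt
  have h2 := (hasGradientAt_phase ξ x).hasFDerivAt.cos
  refine (h1.mul h2).congr_fderiv ?_
  simp only [map_sub, map_smul]
  module

lemma gradient_mul_sin_phase (hφ : TestFun U φ) (ξ x : Euc d) :
    gradient (fun y => φ y * sin (2 * π * inner ℝ y ξ)) x
      = sin (2 * π * inner ℝ x ξ) • gradient φ x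
        + (φ x * cos (2 * π * inner ℝ x ξ)) • (2 * π) • ξ := by
  refine HasGradientAt.gradient ?_
  rw [hasGradientAt_iff_hasFDerivAt]
  have h1 := hφ.differentiable.differentiableAt (x := x) |>.hasGradientAt.hasFDerivAt
  have h2 := (hasGradientAt_phase ξ x).hasFDerivAt.sin
  refine (h1.mul h2).congr_fderiv ?_
  simp only [map_add, map_smul]
  module

lemma sq_norm_gradient_mul_phase (hφ : TestFun U φ) (ξ x : Euc d) :
    ‖gradient (fun y => φ y * cos (2 * π * inner ℝ y ξ)) x‖ ^ 2
      + ‖gradient (fun y => φ y * sin (2 * π * inner ℝ y ξ)) x‖ ^ 2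
      = ‖gradient φ x‖ ^ 2 + (2 * π) ^ 2 * ‖ξ‖ ^ 2 * φ x ^ 2 := by
  rw [gradient_mul_cos_phase hφ, gradient_mul_sin_phase hφ]
  set θ := 2 * π * inner ℝ x ξ
  rw [norm_sub_sq_real, norm_add_sq_real]
  simp only [norm_smul, real_inner_smul_left, real_inner_smul_right, mul_pow, Real.norm_eq_abs,
    sq_abs]
  linear_combination
    (‖gradient φ x‖ ^ 2 + (2 * π) ^ 2 * ‖ξ‖ ^ 2 * φ x ^ 2) * cos_sq_add_sin_sq θ

lemma negForm_phase (hφ : TestFun U φ) (h : ℝ) (ξ : Euc d) {c s : TestSpace U}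
    (hc : ∀ x, φ x * c x = φ x * cos (2 * π * inner ℝ x ξ))
    (hs : ∀ x, φ x * s x = φ x * sin (2 * π * inner ℝ x ξ)) :
    negForm h hφ.1 c c + negForm h hφ.1 s s
      = symbol h ξ * (∫ x, φ x ^ 2) - h ^ 2 * ∫ x, ‖gradient φ x‖ ^ 2 := by
  have hC := hφ.mul_right (contDiff_cos_phase ξ)
  have hS := hφ.mul_right (contDiff_sin_phase ξ)
  have hG : (∫ x, ‖gradient (fun y => φ y * cos (2 * π * inner ℝ y ξ)) x‖ ^ 2)
      + ∫ x, ‖gradient (fun y => φ y * sin (2 * π * inner ℝ y ξ)) x‖ ^ 2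
      = (∫ x, ‖gradient φ x‖ ^ 2) + (2 * π) ^ 2 * ‖ξ‖ ^ 2 * ∫ x, φ x ^ 2 := by
    rw [← integral_add hC.integrable_sq_norm_gradient hS.integrable_sq_norm_gradient,
      ← integral_const_mul, ← integral_add hφ.integrable_sq_norm_gradient
        (hφ.integrable_sq.const_mul _)]
    exact integral_congr_ae (Eventually.of_forall fun x => sq_norm_gradient_mul_phase hφ ξ x)
  have hI := integral_mul_cos_sq_add_mul_sin_sq hφ ξ
  simp only [negForm_apply_self, ← mul_pow, hc, hs, symbol]
  linear_combination hI - h ^ 2 * hG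

lemma exists_orthonormal_lattice_sum_le (hU : IsOpen U) (hφ : TestFun U φ) (h : ℝ) {n : ℕ}
    (hn : 0 < n) (hUn : U ⊆ ball 0 (n / 2)) {κ : Type*} [Fintype κ] {ξ : κ → Euc d}
    {k : κ → Fin d → ℤ} (hk : Function.Injective k) (hξ : ∀ a i, ξ a i = k a i / n) :
    ∃ (m : ℕ) (u : Fin m → TestSpace U), Orthonormal ℝ u ∧
      ((n : ℝ) ^ d)⁻¹ * ∑ a, (symbol h (ξ a) * (∫ x, φ x ^ 2) - h ^ 2 * ∫ x, ‖gradient φ x‖ ^ 2)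
        ≤ ∑ j, negForm h hφ.1 (u j) (u j) := by
  obtain ⟨χ, hχ, hχ1, hφχ⟩ := exists_testFun_cutoff hU hφ
  let c : κ → TestSpace U := fun a => ⟨_, hχ.mul_right (contDiff_cos_phase (ξ a))⟩
  let s : κ → TestSpace U := fun a => ⟨_, hχ.mul_right (contDiff_sin_phase (ξ a))⟩
  have hc : ∀ a x, c a x = χ x * cos (2 * π * inner ℝ x (ξ a)) := fun a x => rfl
  have hs : ∀ a x, s a x = χ x * sin (2 * π * inner ℝ x (ξ a)) := fun a x => rfl
  have hB : ∀ v : TestSpace U,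
      ((n : ℝ) ^ d)⁻¹ * ∑ a, inner ℝ (Sum.elim c s a) v ^ 2 ≤ ‖v‖ ^ 2 := fun v => by
    rw [Fintype.sum_sum_type, ← Finset.sum_add_distrib]
    have hvχ := v.testFun.mul_right hχ.1
    refine le_trans (le_of_eq ?_) ((hvχ.bessel_lattice hn hUn hk hξ).trans ?_)
    · congr 1
      refine Finset.sum_congr rfl fun a _ => ?_
      simp only [Sum.elim_inl, Sum.elim_inr, TestSpace.inner_def, hc, hs]
      congr 3 <;> refine funext fun x => ?_ <;> ring
    · rw [TestSpace.norm_sq]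
      refine integral_mono hvχ.integrable_sq v.testFun.integrable_sq fun x => ?_
      simp only [mul_pow]
      exact mul_le_of_le_one_right (sq_nonneg _) (hχ1 x)
  obtain ⟨m, u, hu, hle⟩ := exists_orthonormal_sum_le (((n : ℝ) ^ d)⁻¹) (by positivity)
    (Sum.elim c s) hB (negForm h hφ.1)
  refine ⟨m, u, hu, le_trans (le_of_eq ?_) hle⟩
  rw [Fintype.sum_sum_type, ← Finset.sum_add_distrib]
  congr 1
  exact Finset.sum_congr rfl fun a _ =>
    (negForm_phase hφ h (ξ a) (c := c a) (s := s a) (fun x => by rw [hc, ← mul_assoc, hφχ])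
      (fun x => by rw [hs, ← mul_assoc, hφχ])).symm

lemma setIntegral_le_of_orthonormal_sum_le (hU : IsOpen U) (hUb : Bornology.IsBounded U)
    (hφ : TestFun U φ) (h : ℝ) {M : ℝ}
    (hM : ∀ (m : ℕ) (u : Fin m → TestSpace U), Orthonormal ℝ u →
      ∑ j, negForm h hφ.1 (u j) (u j) ≤ M) (R : ℝ) :
    ∫ ξ in closedBall (0 : Euc d) R,
      (symbol h ξ * (∫ x, φ x ^ 2) - h ^ 2 * ∫ x, ‖gradient φ x‖ ^ 2) ≤ M := by
  let S : Set (Fin d → ℝ) := WithLp.toLp 2 ⁻¹' closedBall (0 : Euc d) R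
  let G : Euc d → ℝ := fun ξ =>
    symbol h ξ * (∫ x, φ x ^ 2) - h ^ 2 * ∫ x, ‖gradient φ x‖ ^ 2
  have hG : Continuous G := ((continuous_symbol h).mul continuous_const).sub continuous_const
  have hcont : Continuous (WithLp.toLp 2 : (Fin d → ℝ) → Euc d) := PiLp.continuous_toLp 2 _
  have hSb : Bornology.IsBounded S := by
    refine (isBounded_closedBall (x := (0 : Fin d → ℝ)) (r := R)).subset fun x hx => ?_
    rw [mem_closedBall_zero_iff]
    have hx' : ‖(WithLp.toLp 2 x : Euc d)‖ ≤ R := mem_closedBall_zero_iff.1 hx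
    exact (pi_norm_le_iff_of_nonneg ((norm_nonneg _).trans hx')).2 fun i =>
      (PiLp.norm_apply_le (WithLp.toLp 2 x : Euc d) i).trans hx'
  have hSc : Convex ℝ S := (convex_closedBall (0 : Euc d) R).linear_preimage
    (WithLp.linearEquiv 2 ℝ (Fin d → ℝ)).symm.toLinearMap
  have hSm : MeasurableSet S := (isClosed_closedBall.preimage hcont).measurableSet
  have hlim := tendsto_tsum_div_pow_atTop_integral S (fun p => G (WithLp.toLp 2 p))
    (hG.comp hcont) hSb hSm (hSc.addHaar_frontier volume)
  have hint : ∫ p in S, G (WithLp.toLp 2 p) = ∫ ξ in closedBall (0 : Euc d) R, G ξ :=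
    (PiLp.volume_preserving_toLp (Fin d)).setIntegral_preimage_emb
      (MeasurableEquiv.toLp 2 (Fin d → ℝ)).measurableEmbedding G _
  rw [hint] at hlim
  refine le_of_tendsto hlim ?_
  obtain ⟨r, hr⟩ := hUb.subset_ball 0
  filter_upwards [eventually_gt_atTop 0, eventually_ge_atTop ⌈2 * r⌉₊] with n hn hnr
  have hUn : U ⊆ ball 0 (n / 2) := hr.trans (ball_subset_ball (by
    have := Nat.ceil_le.1 hnr
    linarith))
  have : NeZero n := ⟨hn.ne'⟩
  have hn' : (n : ℝ) ≠ 0 := Nat.cast_ne_zero.2 hn.ne'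
  have hfin : Fintype ↑(S ∩ (n : ℝ)⁻¹ •
      (Submodule.span ℤ (range (Pi.basisFun ℝ (Fin d))) : Set (Fin d → ℝ))) := by
    apply Set.Finite.fintype
    rw [← Submodule.coe_pointwise_smul, ZSpan.smul _ (inv_ne_zero hn')]
    exact ZSpan.setFinite_inter _ hSb
  have hmem : ∀ a : ↑(S ∩ (n : ℝ)⁻¹ •
      (Submodule.span ℤ (range (Pi.basisFun ℝ (Fin d))) : Set (Fin d → ℝ))),
      ∃ k : Fin d → ℤ, ∀ i, (a : Fin d → ℝ) i = k i / n := fun a => by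
    have h1 : (a : Fin d → ℝ) ∈
        (n : ℝ)⁻¹ • Submodule.span ℤ (range (Pi.basisFun ℝ (Fin d))) := by
      rw [← SetLike.mem_coe, Submodule.coe_pointwise_smul]
      exact a.2.2
    rw [BoxIntegral.unitPartition.mem_smul_span_iff] at h1
    choose k hk using h1
    refine ⟨k, fun i => ?_⟩
    rw [eq_div_iff hn', mul_comm]
    exact (hk i).symm
  choose k hk using hmem
  have hkinj : Function.Injective k := fun a b hab => by
    refine Subtype.ext (funext fun i => ?_)
    rw [hk, hk, hab]
  obtain ⟨m, u, hu, hle⟩ := exists_orthonormal_lattice_sum_le hU hφ h hn hUn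
    (ξ := fun a => WithLp.toLp 2 a.1) hkinj hk
  refine le_trans (le_of_eq ?_) (hle.trans (hM m u hu))
  rw [tsum_fintype, Fintype.card_fin, div_eq_inv_mul]

end LowerBound

section Volume

variable {d : ℕ}

lemma volumeReal_closedBall (x : Euc d) {r : ℝ} (hr : 0 ≤ r) :
    volume.real (closedBall x r) = r ^ d * ballVol d := by
  rw [Measure.addHaar_real_closedBall _ _ hr, finrank_euclideanSpace_fin]
  rfl

lemma intervalIntegral_pow_mul_symbol (n : ℕ) (h : ℝ) (hh : 0 < h) :
    ∫ y in (0 : ℝ)..(2 * π * h)⁻¹, y ^ n * (1 - (2 * π * h) ^ 2 * y ^ 2)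
      = 2 / ((n + 1) * (n + 3)) * ((2 * π * h)⁻¹) ^ (n + 1) := by
  have h1 : ∀ y : ℝ, y ^ n * (1 - (2 * π * h) ^ 2 * y ^ 2)
      = y ^ n - (2 * π * h) ^ 2 * y ^ (n + 2) := fun y => by ring
  simp only [h1]
  rw [intervalIntegral.integral_sub (by simp) (by simp), intervalIntegral.integral_const_mul,
    integral_pow, integral_pow]
  have h2 : 2 * π * h ≠ 0 := by positivity
  generalize 2 * π * h = a at h2 ⊢
  obtain ⟨b, rfl⟩ : ∃ b, a = b⁻¹ := ⟨a⁻¹, (inv_inv a).symm⟩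
  have h3 : b ≠ 0 := fun h => h2 (by rw [h, inv_zero])
  have h4 : (n : ℝ) + 1 ≠ 0 := by positivity
  have h5 : (n : ℝ) + 3 ≠ 0 := by positivity
  have h6 : (n : ℝ) + 2 + 1 = n + 3 := by ring
  push_cast
  simp only [ne_eq, Nat.succ_ne_zero, not_false_eq_true, zero_pow, inv_inv, h6]
  field_simp
  ring

lemma setIntegral_symbol [NeZero d] {h : ℝ} (hh : 0 < h) :
    ∫ ξ in closedBall (0 : Euc d) (2 * π * h)⁻¹, symbol h ξ = Lconst d * (h ^ d)⁻¹ := by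
  have hne : Nontrivial (Euc d) := by
    rw [← Module.finrank_pos_iff (R := ℝ), finrank_euclideanSpace_fin]
    exact NeZero.pos d
  set R := (2 * π * h)⁻¹ with hR
  have hR0 : 0 ≤ R := by positivity
  let f : ℝ → ℝ := (Iic R).indicator fun y => 1 - (2 * π * h) ^ 2 * y ^ 2
  have h1 : (closedBall (0 : Euc d) R).indicator (symbol h) = fun ξ => f ‖ξ‖ := by
    ext ξ
    by_cases hξ : ‖ξ‖ ≤ R <;> simp [f, symbol, indicator, hξ]
  have h2 : ∀ y : ℝ, y ^ (d - 1) • f y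
      = (Iic R).indicator (fun y => y ^ (d - 1) * (1 - (2 * π * h) ^ 2 * y ^ 2)) y := fun y => by
    by_cases hy : y ≤ R <;> simp [f, hy]
  rw [← integral_indicator measurableSet_closedBall, h1, integral_fun_norm_addHaar,
    finrank_euclideanSpace_fin]
  simp only [h2]
  rw [setIntegral_indicator measurableSet_Iic, Ioi_inter_Iic,
    ← intervalIntegral.integral_of_le hR0, intervalIntegral_pow_mul_symbol _ _ hh,
    Nat.sub_add_cancel (NeZero.pos d), Nat.cast_sub (NeZero.pos d)]
  change d • ballVol d • _ = _
  have hd : (d : ℝ) ≠ 0 := Nat.cast_ne_zero.2 (NeZero.ne d)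
  have hd2 : (d : ℝ) + 2 ≠ 0 := by positivity
  rw [Lconst, nsmul_eq_mul, smul_eq_mul, Nat.cast_one, sub_add_cancel,
    show (d : ℝ) - 1 + 3 = d + 2 by ring, inv_pow, mul_pow _ h]
  field_simp

end Volume

section Asymptotics

variable {d : ℕ} {U : Set (Euc d)} {φ : Euc d → ℝ}

lemma trNeg_eq_sSup (hφ : TestFun U φ) (h : ℝ) :
    trNeg U h φ = sSup {S : ℝ | ∃ (n : ℕ) (u : Fin n → TestSpace U), Orthonormal ℝ u ∧
      S = ∑ j, negForm h hφ.1 (u j) (u j)} := by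
  rw [trNeg]
  congr 1
  ext S
  simp only [mem_ofPred_eq, orthonormal_iff_ite, TestSpace.inner_def, negForm_apply_self]
  constructor
  · rintro ⟨n, v, hv, ho, hS⟩
    exact ⟨n, fun i => ⟨v i, hv i⟩, ho, hS⟩
  · rintro ⟨n, u, ho, hS⟩
    exact ⟨n, fun i => u i, fun i => (u i).testFun, ho, hS⟩

lemma trNeg_le [NeZero d] (hφ : TestFun U φ) {h : ℝ} (hh : 0 < h) :
    trNeg U h φ ≤ Lconst d * (h ^ d)⁻¹ * ∫ x, φ x ^ 2 := by
  rw [trNeg_eq_sSup hφ, ← setIntegral_symbol hh]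
  refine csSup_le ⟨0, 0, Fin.elim0, ⟨Fin.rec0, fun i => i.elim0⟩, by simp⟩ ?_
  rintro _ ⟨n, u, hu, rfl⟩
  exact sum_negForm_le hφ hh hu

lemma sum_negForm_le_trNeg (hφ : TestFun U φ) {h : ℝ} (hh : 0 < h) {n : ℕ}
    {u : Fin n → TestSpace U} (hu : Orthonormal ℝ u) :
    ∑ j, negForm h hφ.1 (u j) (u j) ≤ trNeg U h φ := by
  rw [trNeg_eq_sSup hφ]
  refine le_csSup ⟨(∫ ξ in closedBall (0 : Euc d) (2 * π * h)⁻¹, symbol h ξ) * ∫ x, φ x ^ 2, ?_⟩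
    ⟨n, u, hu, rfl⟩
  rintro _ ⟨n, u, hu, rfl⟩
  exact sum_negForm_le hφ hh hu

lemma le_trNeg [NeZero d] (hU : IsOpen U) (hUb : Bornology.IsBounded U) (hφ : TestFun U φ)
    {h : ℝ} (hh : 0 < h) :
    Lconst d * (h ^ d)⁻¹ * (∫ x, φ x ^ 2)
      - ((2 * π * h)⁻¹) ^ d * ballVol d * (h ^ 2 * ∫ x, ‖gradient φ x‖ ^ 2) ≤ trNeg U h φ := by
  refine le_trans (le_of_eq ?_) (setIntegral_le_of_orthonormal_sum_le hU hUb hφ h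
    (fun m u hu => sum_negForm_le_trNeg hφ hh hu) (2 * π * h)⁻¹)
  have hc : ∀ g : Euc d → ℝ, Continuous g →
      IntegrableOn g (closedBall 0 (2 * π * h)⁻¹) volume := fun _ hg =>
    hg.continuousOn.integrableOn_compact (isCompact_closedBall _ _)
  rw [integral_sub (hc (fun ξ => symbol h ξ * ∫ x, φ x ^ 2)
      ((continuous_symbol h).mul continuous_const)) (hc _ continuous_const),
    integral_mul_const, setIntegral_symbol hh, setIntegral_const,
    volumeReal_closedBall _ (by positivity), smul_eq_mul]

lemma integral_sq_norm_gradient_le (hφ : TestFun U φ) {x₀ : Euc d} {r B : ℝ} (hr : 0 ≤ r)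
    (hsupp : tsupport φ ⊆ closedBall x₀ r) (hB : ∀ x, ‖gradient φ x‖ ≤ B) :
    ∫ x, ‖gradient φ x‖ ^ 2 ≤ B ^ 2 * (r ^ d * ballVol d) := by
  have h0 : ∀ x, x ∉ closedBall x₀ r → ‖gradient φ x‖ ^ 2 = 0 := fun x hx => by
    rw [image_eq_zero_of_notMem_tsupport fun h => hx (hsupp (tsupport_gradient_subset _ h)),
      norm_zero, zero_pow two_ne_zero]
  rw [← setIntegral_eq_integral_of_forall_compl_eq_zero h0, ← volumeReal_closedBall x₀ hr]
  refine (setIntegral_mono (hφ.integrable_sq_norm_gradient.integrableOn)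
    (continuous_const.continuousOn.integrableOn_compact (isCompact_closedBall _ _))
    fun x => pow_le_pow_left₀ (norm_nonneg _) (hB x) 2).trans (le_of_eq ?_)
  rw [setIntegral_const, smul_eq_mul, mul_comm]

end Asymptotics

/-- local asymptotics in the bulk.  If φ ∈ C₀^∞(Ω) is supported in a
ball of radius l and ‖∇φ‖_∞ ≤ C l⁻¹, then for all h > 0,
|Tr(φ H_Ω φ)_- - L_d h^{-d} ∫_Ω φ²| ≤ C' l^{d-2} h^{-d+2}, with C' depending only
on d and the constant C. -/
theorem bulk_asymptotics
    (d : ℕ) (hd : 2 ≤ d) (C : ℝ) (hC : 0 < C) :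
    ∃ C' : ℝ, 0 < C' ∧
      ∀ (Ω : Set (Euc d)), IsOpen Ω → Bornology.IsBounded Ω →
      ∀ (l : ℝ), 0 < l → ∀ (x₀ : Euc d) (φ : Euc d → ℝ),
        TestFun Ω φ →
        tsupport φ ⊆ Metric.closedBall x₀ l →
        (∀ x, ‖gradient φ x‖ ≤ C / l) →
        ∀ h : ℝ, 0 < h →
          |trNeg Ω h φ - Lconst d * h ^ (-(d:ℝ)) * ∫ x in Ω, (φ x)^2|
            ≤ C' * l ^ ((d:ℝ) - 2) * h ^ (-(d:ℝ) + 2) := by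
  have : NeZero d := ⟨by lia⟩
  refine ⟨((2 * π) ^ d)⁻¹ * ballVol d ^ 2 * C ^ 2 + 1, by positivity, ?_⟩
  intro Ω hΩ hΩb l hl x₀ φ hφ hsupp hgrad h hh
  have hint : ∫ x in Ω, φ x ^ 2 = ∫ x, φ x ^ 2 :=
    setIntegral_eq_integral_of_forall_compl_eq_zero fun x hx => by
      rw [image_eq_zero_of_notMem_tsupport fun h => hx (hφ.2.2 h), zero_pow two_ne_zero]
  have hhd : h ^ (-(d : ℝ)) = (h ^ d)⁻¹ := by rw [rpow_neg hh.le, rpow_natCast]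
  have hhd2 : h ^ (-(d : ℝ) + 2) = (h ^ d)⁻¹ * h ^ 2 := by
    rw [rpow_add hh, hhd, rpow_two]
  have hld : l ^ ((d : ℝ) - 2) = l ^ d / l ^ 2 := by
    rw [rpow_sub hl, rpow_natCast, rpow_two]
  rw [hint, hhd, hhd2, hld, abs_le]
  have hupper := trNeg_le hφ hh
  have hlower := le_trNeg hΩ hΩb hφ hh
  have hω : 0 ≤ ballVol d := ENNReal.toReal_nonneg
  have herr : ((2 * π * h)⁻¹) ^ d * ballVol d * (h ^ 2 * ∫ x, ‖gradient φ x‖ ^ 2)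
      ≤ (((2 * π) ^ d)⁻¹ * ballVol d ^ 2 * C ^ 2 + 1) * (l ^ d / l ^ 2) * ((h ^ d)⁻¹ * h ^ 2) :=
    calc
      _ ≤ ((2 * π * h)⁻¹) ^ d * ballVol d * (h ^ 2 * ((C / l) ^ 2 * (l ^ d * ballVol d))) := by
        gcongr
        exact integral_sq_norm_gradient_le hφ hl.le hsupp hgrad
      _ = ((2 * π) ^ d)⁻¹ * ballVol d ^ 2 * C ^ 2 * (l ^ d / l ^ 2) * ((h ^ d)⁻¹ * h ^ 2) := by
        rw [inv_pow, mul_pow _ h, mul_inv]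
        ring
      _ ≤ _ := by
        gcongr
        exact le_add_of_nonneg_right zero_le_one
  have hE : 0 ≤ (((2 * π) ^ d)⁻¹ * ballVol d ^ 2 * C ^ 2 + 1) * (l ^ d / l ^ 2)
      * ((h ^ d)⁻¹ * h ^ 2) := by positivity
  constructor <;> linarith
end
end

section
/- Let d ≥ 2 and let Ω ⊂ ℝ^d be a bounded open set. For every real φ ∈ C₀^∞(ℝ^d) and every h > 0, Tr(φ H_Ω φ)_− ≤ L_d h^{−d} ∫_{ℝ^d} φ(x)² dx. -/
open MeasureTheory Real Metric Set

noncomputable section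

open scoped FourierTransform LineDeriv SchwartzMap

/-- Bessel's inequality for a finite orthonormal family of square-integrable functions. -/
lemma bessel_integral {X : Type*} [MeasurableSpace X] {μ : Measure X} {n : ℕ}
    {v : Fin n → X → ℂ} {g : X → ℂ} (hv : ∀ i, MemLp (v i) 2 μ) (hg : MemLp g 2 μ)
    (hvo : ∀ i j, ∫ x, v j x * starRingEnd ℂ (v i x) ∂μ = if i = j then 1 else 0) :
    ∑ i, ‖∫ x, g x * starRingEnd ℂ (v i x) ∂μ‖ ^ 2 ≤ ∫ x, ‖g x‖ ^ 2 ∂μ := by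
  have key : ∀ {a b : X → ℂ} (ha : MemLp a 2 μ) (hb : MemLp b 2 μ),
      inner ℂ (ha.toLp a) (hb.toLp b) = ∫ x, b x * starRingEnd ℂ (a x) ∂μ := by
    intro a b ha hb
    rw [L2.inner_def]
    refine integral_congr_ae ?_
    filter_upwards [ha.coeFn_toLp, hb.coeFn_toLp] with x h1 h2
    rw [h1, h2]; rfl
  have ho : Orthonormal ℂ (fun i => (hv i).toLp (v i)) := by
    rw [orthonormal_iff_ite]
    intro i j
    rw [key, hvo]
  have hb := ho.sum_inner_products_le (hg.toLp g) (s := Finset.univ)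
  simp_rw [key] at hb
  refine hb.trans_eq ?_
  have h2 : ((‖hg.toLp g‖ ^ 2 : ℝ) : ℂ) = ((∫ x, ‖g x‖ ^ 2 ∂μ : ℝ) : ℂ) := by
    have := inner_self_eq_norm_sq_to_K (𝕜 := ℂ) (hg.toLp g)
    rw [key] at this
    rw [← integral_complex_ofReal]
    push_cast
    refine this.symm.trans ?_
    congr 1
    ext x
    exact Complex.mul_conj' _
  exact_mod_cast h2

/-- Pointwise Bessel bound for the Fourier transforms of `φ v_j`. -/
lemma sum_norm_sq_fourier_mul_le {d n : ℕ} {φ : Euc d → ℝ} {v : Fin n → Euc d → ℝ}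
    (hφ : MemLp φ 2) (hv : ∀ i, MemLp (v i) 2)
    (hvo : ∀ i j, (∫ x : Euc d, v i x * v j x) = if i = j then (1 : ℝ) else 0) (ξ : Euc d) :
    ∑ j, ‖𝓕 (fun x => ((φ x * v j x : ℝ) : ℂ)) ξ‖ ^ 2 ≤ ∫ x, (φ x) ^ 2 := by
  have hcont : Continuous fun x : Euc d => Complex.exp (↑(-2 * π * inner ℝ x ξ) * Complex.I) := by
    fun_prop
  have hg : MemLp (fun x => Complex.exp (↑(-2 * π * inner ℝ x ξ) * Complex.I) * (φ x : ℂ)) 2 := by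
    refine (hφ.ofReal (K := ℂ)).of_le (hcont.aestronglyMeasurable.mul
      (hφ.ofReal (K := ℂ)).aestronglyMeasurable) (.of_forall fun x => ?_)
    rw [norm_mul, Complex.norm_exp_ofReal_mul_I, one_mul]
    rfl
  have hb := bessel_integral (fun i => (hv i).ofReal (K := ℂ)) hg (fun i j => by
    have h1 : ∀ x, ((v j x : ℝ) : ℂ) * starRingEnd ℂ ((v i x : ℝ) : ℂ)
        = ((v i x * v j x : ℝ) : ℂ) := by
      intro x; rw [Complex.conj_ofReal]; push_cast; ring
    refine (integral_congr_ae (.of_forall h1)).trans ?_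
    rw [integral_complex_ofReal, hvo]
    split_ifs <;> simp)
  calc _ = _ := by
        refine Finset.sum_congr rfl fun j _ => ?_
        rw [Real.fourier_eq']
        congr 3
        ext x
        change _ = _ * starRingEnd ℂ ((v j x : ℝ) : ℂ)
        rw [Complex.conj_ofReal, smul_eq_mul]
        push_cast; ring
    _ ≤ _ := hb
    _ = _ := by
        congr 1
        ext x
        rw [norm_mul, Complex.norm_exp_ofReal_mul_I, one_mul, Complex.norm_real,
          norm_eq_abs, sq_abs]

/-- The quadratic form of `-h²Δ - 1` in momentum space. -/
lemma integral_sq_sub_gradient_eq {d : ℕ} {f : Euc d → ℝ} (hf : ContDiff ℝ (⊤ : ℕ∞) f)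
    (hfc : HasCompactSupport f) (h : ℝ) :
    Integrable (fun ξ : Euc d => (1 - (2 * π * h * ‖ξ‖) ^ 2) * ‖𝓕 (fun x => (f x : ℂ)) ξ‖ ^ 2) ∧
    (∫ x, (f x) ^ 2) - h ^ 2 * ∫ x, ‖gradient f x‖ ^ 2 =
      ∫ ξ, (1 - (2 * π * h * ‖ξ‖) ^ 2) * ‖𝓕 (fun x => (f x : ℂ)) ξ‖ ^ 2 := by
  have hcc : HasCompactSupport (fun x => (f x : ℂ)) := hfc.comp_left (g := ((↑) : ℝ → ℂ)) rfl
  have hcd : ContDiff ℝ (⊤ : ℕ∞) (fun x => (f x : ℂ)) := Complex.ofRealCLM.contDiff.comp hf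
  let F : 𝓢(Euc d, ℂ) := hcc.toSchwartzMap hcd
  have hFcoe : ∀ x, F x = (f x : ℂ) := fun x => rfl
  have hFF : 𝓕 (fun x => (f x : ℂ)) = (𝓕 F : 𝓢(Euc d, ℂ)) := (SchwartzMap.fourier_coe F).symm
  have sqint : ∀ g : 𝓢(Euc d, ℂ), Integrable (fun x => ‖g x‖ ^ 2) := fun g =>
    (g.memLp 2).norm.integrable_sq
  let e := EuclideanSpace.basisFun (Fin d) ℝ
  have hder : ∀ i x, ∂_{e i} F x = ((inner ℝ (gradient f x) (e i) : ℝ) : ℂ) := by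
    intro i x
    rw [SchwartzMap.lineDerivOp_apply_eq_fderiv]
    have h1 : HasFDerivAt F (Complex.ofRealCLM.comp (fderiv ℝ f x)) x :=
      Complex.ofRealCLM.hasFDerivAt.comp x
        ((hf.differentiable (by simp)).differentiableAt.hasFDerivAt)
    rw [h1.fderiv, gradient, InnerProductSpace.toDual_symm_apply]
    rfl
  have hfour : ∀ i ξ, ‖𝓕 (∂_{e i} F) ξ‖ ^ 2 = (2 * π) ^ 2 * (ξ i ^ 2 * ‖𝓕 F ξ‖ ^ 2) := by
    intro i ξ
    have ht : (inner ℝ · (e i) : Euc d → ℝ).HasTemperateGrowth :=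
      ((innerSL ℝ).flip (e i)).hasTemperateGrowth
    have hi : inner ℝ ξ (e i) = ξ i := by
      simpa [e] using (EuclideanSpace.inner_single_right (𝕜 := ℝ) i 1 ξ)
    rw [SchwartzMap.fourier_lineDerivOp_eq, smul_apply,
      SchwartzMap.smulLeftCLM_apply_apply ht, hi, norm_smul, norm_smul, mul_pow, mul_pow]
    simp [mul_pow]
  have hsumg : ∀ x, ‖gradient f x‖ ^ 2 = ∑ i, ‖∂_{e i} F x‖ ^ 2 := by
    intro x
    rw [← e.sum_sq_norm_inner_left (gradient f x)]
    refine Finset.sum_congr rfl fun i _ => ?_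
    rw [hder, Complex.norm_real]
  have hint : ∀ i, Integrable (fun ξ : Euc d => (2 * π) ^ 2 * (ξ i ^ 2 * ‖𝓕 F ξ‖ ^ 2)) := by
    intro i
    simpa only [hfour] using sqint (𝓕 (∂_{e i} F))
  have hgrad : ∫ x, ‖gradient f x‖ ^ 2 = ∫ ξ, ∑ i, (2 * π) ^ 2 * (ξ i ^ 2 * ‖𝓕 F ξ‖ ^ 2) := by
    simp_rw [hsumg]
    rw [integral_finsetSum _ fun i _ => sqint _, integral_finsetSum _ fun i _ => hint i]
    refine Finset.sum_congr rfl fun i _ => ?_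
    rw [← SchwartzMap.integral_norm_sq_fourier]
    simp_rw [hfour]
  have hL2 : ∫ x, (f x) ^ 2 = ∫ ξ, ‖𝓕 F ξ‖ ^ 2 := by
    rw [SchwartzMap.integral_norm_sq_fourier]
    simp [hFcoe]
  have hid : ∀ ξ : Euc d, (1 - (2 * π * h * ‖ξ‖) ^ 2) * ‖𝓕 F ξ‖ ^ 2 =
      ‖𝓕 F ξ‖ ^ 2 - h ^ 2 * ∑ i, (2 * π) ^ 2 * (ξ i ^ 2 * ‖𝓕 F ξ‖ ^ 2) := by
    intro ξ
    rw [← Finset.mul_sum, ← Finset.sum_mul, ← EuclideanSpace.real_norm_sq_eq]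
    ring
  have hI := (integrable_finsetSum Finset.univ fun i _ => hint i).const_mul (h ^ 2)
  rw [hFF]
  simp_rw [hid]
  refine ⟨(sqint (𝓕 F)).sub hI, ?_⟩
  rw [integral_sub (sqint _) hI, integral_const_mul, hL2, hgrad]

/-- The phase-space integral of the negative part of the symbol, with its integrability. -/
lemma integral_symbol {d : ℕ} (hd : 2 ≤ d) {h : ℝ} (hh : 0 < h) :
    Integrable (fun ξ : Euc d => max (1 - (2 * π * h * ‖ξ‖) ^ 2) 0) ∧
    ∫ ξ : Euc d, max (1 - (2 * π * h * ‖ξ‖) ^ 2) 0 = Lconst d * h ^ (-(d : ℝ)) := by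
  have : Nontrivial (Euc d) := by
    have : Nonempty (Fin d) := ⟨⟨0, by omega⟩⟩
    infer_instance
  set c := 2 * π * h with hc
  have hc0 : 0 < c := by positivity
  have hzero : ∀ r : ℝ, r ∈ Ioi 0 \ Ioc 0 c⁻¹ → r ^ (d - 1) • max (1 - (c * r) ^ 2) 0 = 0 := by
    rintro r ⟨hr0, hr⟩
    have hr1 : c⁻¹ < r := by
      by_contra! hcon
      exact hr ⟨hr0, hcon⟩
    have h1 : 1 < c * r := by
      rwa [inv_lt_iff_one_lt_mul₀' hc0] at hr1
    rw [max_eq_right (by nlinarith), smul_zero]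
  constructor
  · rw [integrable_fun_norm_addHaar volume (f := fun r => max (1 - (c * r) ^ 2) 0),
      finrank_euclideanSpace_fin]
    refine IntegrableOn.of_forall_sdiff_eq_zero (s := Ioc 0 c⁻¹) ?_ measurableSet_Ioi hzero
    exact (Continuous.integrableOn_Ioc (by fun_prop))
  · rw [integral_fun_norm_addHaar volume (fun r => max (1 - (c * r) ^ 2) 0),
      finrank_euclideanSpace_fin,
      setIntegral_eq_of_subset_of_forall_sdiff_eq_zero measurableSet_Ioi Ioc_subset_Ioi_self hzero]
    have h1 : ∫ r in Ioc 0 c⁻¹, r ^ (d - 1) • max (1 - (c * r) ^ 2) 0 =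
        ∫ r in Ioc 0 c⁻¹, (r ^ (d - 1) - c ^ 2 * r ^ (d + 1)) := by
      refine setIntegral_congr_fun measurableSet_Ioc fun r hr => ?_
      have h2 : c * r ≤ 1 := by
        have := mul_le_mul_of_nonneg_left hr.2 hc0.le
        rwa [mul_inv_cancel₀ hc0.ne'] at this
      have h3 : 0 ≤ c * r := mul_nonneg hc0.le hr.1.le
      obtain ⟨k, rfl⟩ : ∃ k, d = k + 1 := ⟨d - 1, by omega⟩
      simp only [smul_eq_mul, Nat.add_sub_cancel]
      rw [max_eq_left (by nlinarith)]
      ring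
    rw [h1, ← intervalIntegral.integral_of_le (inv_pos.2 hc0).le,
      intervalIntegral.integral_sub (by simp) (by simp [intervalIntegral.intervalIntegrable_pow]),
      intervalIntegral.integral_const_mul, integral_pow, integral_pow]
    have h4 : h ^ (-(d : ℝ)) = (h ^ d)⁻¹ := by
      rw [Real.rpow_neg hh.le, Real.rpow_natCast]
    have h5 : (((d - 1 : ℕ) : ℝ) + 1) = d := by
      rw [← Nat.cast_succ]; congr 1; omega
    have hd0 : (d : ℝ) ≠ 0 := by positivity
    rw [h4, h5, Lconst, ballVol, Nat.sub_add_cancel (by omega : 1 ≤ d), hc]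
    push_cast
    rw [zero_pow (by omega), zero_pow (by omega)]
    simp only [nsmul_eq_mul, smul_eq_mul, Measure.real, inv_pow, mul_pow, pow_succ]
    field_simp
    ring

/-- Berezin–Lieb–Li–Yau type bound: for any real φ ∈ C₀^∞(ℝ^d) and
h > 0, Tr(φ H_Ω φ)_- ≤ L_d h^{-d} ∫_{ℝ^d} φ². -/
theorem berezin_bound
    (d : ℕ) (hd : 2 ≤ d) (Ω : Set (Euc d)) (hΩo : IsOpen Ω)
    (hΩb : Bornology.IsBounded Ω)
    (φ : Euc d → ℝ) (hφ : ContDiff ℝ (⊤ : ℕ∞) φ) (hφc : HasCompactSupport φ)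
    (h : ℝ) (hh : 0 < h) :
    trNeg Ω h φ ≤ Lconst d * h ^ (-(d:ℝ)) * ∫ x : Euc d, (φ x)^2 := by
  have hφ2 : MemLp φ 2 := hφ.continuous.memLp_of_hasCompactSupport hφc
  obtain ⟨hsi, hse⟩ := integral_symbol hd hh
  rw [← hse]
  have hI0 : 0 ≤ ∫ x : Euc d, (φ x) ^ 2 := integral_nonneg fun x => sq_nonneg _
  refine Real.sSup_le ?_ (mul_nonneg (integral_nonneg fun ξ => le_max_right _ _) hI0)
  rintro S ⟨n, v, hv, hvo, rfl⟩
  have hform := fun j => integral_sq_sub_gradient_eq (f := fun y => φ y * v j y)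
    (hφ.mul (hv j).1) hφc.mul_right h
  have hbess := sum_norm_sq_fourier_mul_le hφ2
    (fun i => (hv i).1.continuous.memLp_of_hasCompactSupport (hv i).2.1) hvo
  simp_rw [← mul_pow]
  rw [Finset.sum_congr rfl fun j _ => (hform j).2, ← integral_finsetSum _ fun j _ => (hform j).1,
    ← integral_mul_const]
  refine integral_mono (integrable_finsetSum _ fun j _ => (hform j).1) (hsi.mul_const _) fun ξ => ?_
  simp only
  rw [← Finset.mul_sum]
  exact mul_le_mul (le_max_left _ _) (hbess ξ) (Finset.sum_nonneg fun j _ => sq_nonneg _)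
    (le_max_right _ _)
end
end

section
/- Let d ≥ 2. Then the iterated integral ∫₀^∞ ( ∫_{ℝ^d} cos(2ξ_d t)(1 − |ξ|²)_+ dξ ) dt converges and equals π ω_{d−1}/(d+1). Equivalently, (2π)^{−d} ∫₀^∞ ∫_{ℝ^d} cos(2ξ_d t)(|ξ|² − 1)_− dξ dt = L_{d−1}/4, where L_{d−1} = 2ω_{d−1}/((d+1)(2π)^{d−1}). -/
open MeasureTheory Real Metric Set

noncomputable section

/-- Last coordinate of x ∈ ℝ^d. -/
def lastCoord {d : ℕ} (x : Euc d) : ℝ :=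
  if h : 0 < d then x ⟨d - 1, by omega⟩ else 0

/-- The radial integral `∫ (1 - |y|²)₊ dy` over `ℝⁿ`. -/
theorem integral_max_one_sub_norm_sq (n : ℕ) (hn : 1 ≤ n) :
    ∫ y : Euc n, max (1 - ‖y‖ ^ 2) 0 = 2 * ballVol n / (n + 2) := by
  have : Nonempty (Fin n) := ⟨⟨0, hn⟩⟩
  have hradial : ∫ y in Ioi (0 : ℝ), y ^ (n - 1) * max (1 - y ^ 2) 0 = 2 / (n * (n + 2)) := by
    have hsupp : ∫ y in Ioi (0 : ℝ), y ^ (n - 1) * max (1 - y ^ 2) 0 =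
        ∫ y in Ioc (0 : ℝ) 1, y ^ (n - 1) * max (1 - y ^ 2) 0 := by
      refine setIntegral_eq_of_subset_of_forall_sdiff_eq_zero measurableSet_Ioi
        Ioc_subset_Ioi_self fun y hy => ?_
      have hy1 : 1 < y := by
        by_contra! h
        exact hy.2 (mem_Ioc.2 ⟨hy.1, h⟩)
      rw [max_eq_right (by nlinarith), mul_zero]
    have hpow : ∫ y in (0 : ℝ)..1, y ^ (n - 1) * max (1 - y ^ 2) 0 =
        ∫ y in (0 : ℝ)..1, (y ^ (n - 1) - y ^ (n + 1)) := by
      refine intervalIntegral.integral_congr fun y hy => ?_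
      rw [uIcc_of_le zero_le_one] at hy
      have h1 : y ^ (n + 1) = y ^ (n - 1) * y ^ 2 := by
        rw [← pow_add]
        congr 1
        omega
      rw [max_eq_left (by nlinarith [hy.1, hy.2]), h1]
      ring
    rw [hsupp, ← intervalIntegral.integral_of_le zero_le_one, hpow,
      intervalIntegral.integral_sub (by simp) (by simp), integral_pow, integral_pow]
    have hcast : ((n - 1 : ℕ) : ℝ) + 1 = n := by
      rw [Nat.cast_sub hn]
      simp
    rw [hcast]
    have hn0 : (n : ℝ) ≠ 0 := by positivity
    simp
    field_simp
    ring
  have hpolar := integral_fun_norm_addHaar (volume : Measure (Euc n))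
    (fun r : ℝ => max (1 - r ^ 2) 0)
  simp only [finrank_euclideanSpace, Fintype.card_fin, smul_eq_mul, nsmul_eq_mul] at hpolar
  rw [hpolar, hradial, ballVol, Measure.real]
  have hn0 : (n : ℝ) ≠ 0 := by positivity
  field_simp

/-- The integral of `(1 - |ξ|²)₊` over a horizontal slice of `ℝⁿ⁺¹`. -/
theorem integral_slice (n : ℕ) (hn : 1 ≤ n) (s : ℝ) :
    ∫ y : Euc n, max (1 - s ^ 2 - ‖y‖ ^ 2) 0 =
      √(1 - s ^ 2) ^ (n + 2) * (2 * ballVol n / (n + 2)) := by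
  rcases le_or_gt (1 - s ^ 2) 0 with hs | hs
  · rw [Real.sqrt_eq_zero_of_nonpos hs, zero_pow (by omega), zero_mul]
    refine integral_eq_zero_of_ae (Filter.Eventually.of_forall fun y => ?_)
    exact max_eq_right (by nlinarith [sq_nonneg ‖y‖])
  · set r := √(1 - s ^ 2) with hr
    have hr0 : 0 < r := Real.sqrt_pos.2 hs
    have hr2 : r ^ 2 = 1 - s ^ 2 := Real.sq_sqrt hs.le
    have hscale := Measure.integral_comp_smul (volume : Measure (Euc n))
      (fun y => max (1 - s ^ 2 - ‖y‖ ^ 2) 0) r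
    have hpoint (y : Euc n) :
        max (1 - s ^ 2 - ‖r • y‖ ^ 2) 0 = r ^ 2 * max (1 - ‖y‖ ^ 2) 0 := by
      rw [norm_smul, Real.norm_of_nonneg hr0.le, mul_max_of_nonneg _ _ (sq_nonneg r), ← hr2]
      congr 1 <;> ring
    simp only [hpoint, integral_const_mul, integral_max_one_sub_norm_sq n hn,
      finrank_euclideanSpace, Fintype.card_fin, smul_eq_mul] at hscale
    rw [abs_of_pos (by positivity), eq_comm, inv_mul_eq_iff_eq_mul₀ (by positivity)] at hscale
    rw [hscale]
    ring

/-- The measurable equivalence `ℝⁿ⁺¹ ≃ ℝ × ℝⁿ` splitting off the last coordinate. -/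
def splitLast (n : ℕ) : Euc (n + 1) ≃ᵐ ℝ × Euc n :=
  ((MeasurableEquiv.toLp 2 (Fin (n + 1) → ℝ)).symm.trans
    (MeasurableEquiv.piFinSuccAbove (fun _ => ℝ) (Fin.last n))).trans
    ((MeasurableEquiv.refl ℝ).prodCongr (MeasurableEquiv.toLp 2 (Fin n → ℝ)))

theorem measurePreserving_splitLast (n : ℕ) : MeasurePreserving (splitLast n) :=
  ((MeasurePreserving.id volume).prod
      (EuclideanSpace.volume_preserving_symm_measurableEquiv_toLp (Fin n)).symm).comp
    ((volume_preserving_piFinSuccAbove (fun _ => ℝ) (Fin.last n)).comp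
      (EuclideanSpace.volume_preserving_symm_measurableEquiv_toLp (Fin (n + 1))))

theorem splitLast_fst (n : ℕ) (ξ : Euc (n + 1)) : (splitLast n ξ).1 = lastCoord ξ := by
  simp only [lastCoord, Nat.zero_lt_succ, dite_true]
  rfl

theorem norm_sq_eq_splitLast (n : ℕ) (ξ : Euc (n + 1)) :
    ‖ξ‖ ^ 2 = (splitLast n ξ).1 ^ 2 + ‖(splitLast n ξ).2‖ ^ 2 := by
  rw [EuclideanSpace.real_norm_sq_eq, EuclideanSpace.real_norm_sq_eq,
    Fin.sum_univ_succAbove _ (Fin.last n)]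
  rfl

theorem integral_cos_lastCoord (n : ℕ) (hn : 1 ≤ n) (t : ℝ) :
    ∫ ξ : Euc (n + 1), cos (2 * lastCoord ξ * t) * max (1 - ‖ξ‖ ^ 2) 0 =
      (2 * ballVol n / (n + 2)) * ∫ s : ℝ, cos (2 * s * t) * √(1 - s ^ 2) ^ (n + 2) := by
  set h : ℝ × Euc n → ℝ := fun p => cos (2 * p.1 * t) * max (1 - p.1 ^ 2 - ‖p.2‖ ^ 2) 0
  have hsplit (ξ : Euc (n + 1)) :
      cos (2 * lastCoord ξ * t) * max (1 - ‖ξ‖ ^ 2) 0 = h (splitLast n ξ) := by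
    simp only [h, norm_sq_eq_splitLast, splitLast_fst]
    ring_nf
  have hcont : Continuous h := by fun_prop
  have hint : Integrable h := by
    refine hcont.integrable_of_hasCompactSupport
      (HasCompactSupport.intro (isCompact_closedBall (0 : ℝ × Euc n) 1) fun p hp => ?_)
    have hp' : 1 < ‖p.1‖ ∨ 1 < ‖p.2‖ := by
      simpa [Prod.norm_def, -not_le, not_le, imp_iff_not_or] using hp
    have : 1 - p.1 ^ 2 - ‖p.2‖ ^ 2 ≤ 0 := by
      rw [← sq_abs p.1, ← Real.norm_eq_abs]
      rcases hp' with h | h <;> nlinarith [norm_nonneg p.1, norm_nonneg p.2]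
    simp only [h, max_eq_right this, mul_zero]
  simp only [hsplit]
  rw [(measurePreserving_splitLast n).integral_comp (splitLast n).measurableEmbedding h,
    Measure.volume_eq_prod, integral_prod h hint, ← integral_const_mul]
  refine integral_congr_ae (Filter.Eventually.of_forall fun s => ?_)
  simp only [h, integral_const_mul, integral_slice n hn]
  ring

/-- The cosine transform of `s ↦ (1 - s²)₊^(m/2)`. -/
def cosTransform (m : ℕ) (t : ℝ) : ℝ := ∫ s : ℝ, cos (2 * s * t) * √(1 - s ^ 2) ^ m

theorem sqrt_one_sub_sq_eq_zero {s : ℝ} (hs : s ∉ Icc (-1 : ℝ) 1) : √(1 - s ^ 2) = 0 := by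
  refine Real.sqrt_eq_zero_of_nonpos ?_
  by_contra! h
  exact hs ⟨by nlinarith, by nlinarith⟩

theorem cosTransform_eq_trig (m : ℕ) (hm : m ≠ 0) (t : ℝ) :
    cosTransform m t = ∫ θ in (-(π / 2))..(π / 2), cos (2 * sin θ * t) * cos θ ^ (m + 1) := by
  have hsupp : cosTransform m t =
      ∫ s in (-1 : ℝ)..1, cos (2 * s * t) * √(1 - s ^ 2) ^ m := by
    rw [intervalIntegral.integral_of_le (by norm_num), ← integral_Icc_eq_integral_Ioc,
      cosTransform]
    refine (setIntegral_eq_integral_of_forall_compl_eq_zero fun s hs => ?_).symm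
    rw [sqrt_one_sub_sq_eq_zero hs, zero_pow hm, mul_zero]
  have hsub := intervalIntegral.integral_comp_mul_deriv (a := -(π / 2)) (b := π / 2)
    (g := fun s => cos (2 * s * t) * √(1 - s ^ 2) ^ m) (fun θ _ => hasDerivAt_sin θ)
    continuous_cos.continuousOn (by fun_prop)
  rw [sin_neg, sin_pi_div_two] at hsub
  rw [hsupp, ← hsub]
  refine intervalIntegral.integral_congr fun θ hθ => ?_
  rw [uIcc_of_le (by linarith [pi_pos])] at hθ
  simp only [Function.comp_apply]
  rw [← abs_cos_eq_sqrt_one_sub_sin_sq, abs_of_nonneg (cos_nonneg_of_mem_Icc hθ)]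
  ring

theorem continuous_cosTransform (m : ℕ) (hm : m ≠ 0) : Continuous (cosTransform m) := by
  rw [funext (cosTransform_eq_trig m hm)]
  exact intervalIntegral.continuous_parametric_intervalIntegral_of_continuous'
    (by fun_prop) _ _

theorem abs_cosTransform_le (m : ℕ) (hm : m ≠ 0) (t : ℝ) : |cosTransform m t| ≤ π := by
  rw [cosTransform_eq_trig m hm]
  refine (intervalIntegral.norm_integral_le_of_norm_le_const (E := ℝ) (C := 1)
    fun θ _ => ?_).trans ?_
  · rw [norm_mul, norm_pow]
    exact mul_le_one₀ (abs_cos_le_one _) (by positivity)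
      (pow_le_one₀ (norm_nonneg _) (abs_cos_le_one _))
  · rw [abs_of_pos (by linarith [pi_pos])]
    linarith

/-- Two integrations by parts in the trigonometric form of the cosine transform. -/
theorem sq_mul_cosTransform (k : ℕ) (t : ℝ) :
    4 * t ^ 2 * cosTransform (k + 3) t =
      (k + 3) * ∫ θ in (-(π / 2))..(π / 2), cos (2 * sin θ * t) *
        (cos θ ^ (k + 2) - (k + 1) * cos θ ^ k * sin θ ^ 2) := by
  have hinner (θ : ℝ) : HasDerivAt (fun θ => 2 * sin θ * t) (2 * cos θ * t) θ :=
    ((hasDerivAt_sin θ).const_mul 2).mul_const t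
  have hpow (j : ℕ) (θ : ℝ) :
      HasDerivAt (fun θ => cos θ ^ (j + 1)) (-((j + 1) * cos θ ^ j * sin θ)) θ := by
    refine ((hasDerivAt_cos θ).pow (j + 1)).congr_deriv ?_
    push_cast
    ring
  have hfirst := intervalIntegral.integral_mul_deriv_eq_deriv_mul (a := -(π / 2)) (b := π / 2)
    (fun θ _ => hpow (k + 2) θ) (fun θ _ => (hinner θ).sin)
    (Continuous.intervalIntegrable (by fun_prop) _ _)
    (Continuous.intervalIntegrable (by fun_prop) _ _)
  have hsecond := intervalIntegral.integral_mul_deriv_eq_deriv_mul (a := -(π / 2)) (b := π / 2)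
    (fun θ _ => (hpow k θ).mul (hasDerivAt_sin θ)) (fun θ _ => (hinner θ).cos)
    (Continuous.intervalIntegrable (by fun_prop) _ _)
    (Continuous.intervalIntegrable (by fun_prop) _ _)
  simp only [Pi.mul_apply, cos_neg, cos_pi_div_two, ne_eq, Nat.succ_ne_zero, not_false_eq_true,
    zero_pow, zero_mul, sub_zero, zero_sub, ← intervalIntegral.integral_neg] at hfirst hsecond
  rw [cosTransform_eq_trig _ (by omega)]
  have h1 : 2 * t * ∫ θ in (-(π / 2))..(π / 2), cos (2 * sin θ * t) * cos θ ^ (k + 3 + 1) =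
      (k + 3) * ∫ θ in (-(π / 2))..(π / 2), cos θ ^ (k + 2) * sin θ * sin (2 * sin θ * t) := by
    rw [← intervalIntegral.integral_const_mul, ← intervalIntegral.integral_const_mul]
    refine Eq.trans ?_ (hfirst.trans ?_)
    · congr 1; ext θ; ring
    · congr 1; ext θ; push_cast; ring
  have h2 : 2 * t * ∫ θ in (-(π / 2))..(π / 2), cos θ ^ (k + 2) * sin θ * sin (2 * sin θ * t) =
      ∫ θ in (-(π / 2))..(π / 2), cos (2 * sin θ * t) *
        (cos θ ^ (k + 2) - (k + 1) * cos θ ^ k * sin θ ^ 2) := by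
    rw [← intervalIntegral.integral_const_mul, ← neg_inj, ← intervalIntegral.integral_neg,
      ← intervalIntegral.integral_neg]
    refine Eq.trans ?_ (hsecond.trans ?_)
    · congr 1; ext θ; ring
    · congr 1; ext θ; ring
  rw [← h2]
  linear_combination 2 * t * h1

theorem sq_mul_abs_cosTransform_le (k : ℕ) (t : ℝ) :
    t ^ 2 * |cosTransform (k + 3) t| ≤ (k + 3) * (k + 2) * π := by
  have hbound : |∫ θ in (-(π / 2))..(π / 2), cos (2 * sin θ * t) *
      (cos θ ^ (k + 2) - (k + 1) * cos θ ^ k * sin θ ^ 2)| ≤ (k + 2) * π := by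
    refine (intervalIntegral.norm_integral_le_of_norm_le_const (E := ℝ) (C := (k : ℝ) + 2)
      fun θ _ => ?_).trans ?_
    · have hc (j : ℕ) : |cos θ ^ j| ≤ 1 := by
        rw [abs_pow]
        exact pow_le_one₀ (abs_nonneg _) (abs_cos_le_one _)
      have hs : |sin θ ^ 2| ≤ 1 := by
        rw [abs_pow]
        exact pow_le_one₀ (abs_nonneg _) (abs_sin_le_one _)
      have hprod : |cos θ ^ k * sin θ ^ 2| ≤ 1 := by
        rw [abs_mul]
        exact mul_le_one₀ (hc k) (abs_nonneg _) hs
      have hk : (0 : ℝ) ≤ k + 1 := by positivity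
      have hdiff : |cos θ ^ (k + 2) - (k + 1) * cos θ ^ k * sin θ ^ 2| ≤ (k : ℝ) + 2 := by
        have hmul : |(k + 1) * (cos θ ^ k * sin θ ^ 2)| ≤ (k : ℝ) + 1 := by
          rw [abs_mul, abs_of_nonneg hk]
          exact mul_le_of_le_one_right hk hprod
        rw [mul_assoc]
        linarith [hc (k + 2), norm_sub_le (cos θ ^ (k + 2)) ((k + 1) * (cos θ ^ k * sin θ ^ 2)),
          Real.norm_eq_abs (cos θ ^ (k + 2)),
          Real.norm_eq_abs ((k + 1) * (cos θ ^ k * sin θ ^ 2)),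
          Real.norm_eq_abs (cos θ ^ (k + 2) - (k + 1) * (cos θ ^ k * sin θ ^ 2))]
      rw [Real.norm_eq_abs, abs_mul]
      exact (mul_le_of_le_one_left (abs_nonneg _) (abs_cos_le_one _)).trans hdiff
    · rw [abs_of_pos (by linarith [pi_pos])]
      linarith
  have heq := congrArg abs (sq_mul_cosTransform k t)
  rw [abs_mul, abs_mul _ (∫ _ in _.._, _), abs_of_nonneg (by positivity : 0 ≤ 4 * t ^ 2),
    abs_of_nonneg (by positivity : (0 : ℝ) ≤ k + 3)] at heq
  have hmul := mul_le_mul_of_nonneg_left hbound (by positivity : (0 : ℝ) ≤ k + 3)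
  nlinarith [mul_nonneg (sq_nonneg t) (abs_nonneg (cosTransform (k + 3) t))]

theorem integrable_cosTransform (k : ℕ) : Integrable (cosTransform (k + 3)) := by
  refine (integrable_inv_one_add_sq.const_mul (π + (k + 3) * (k + 2) * π)).mono'
    (continuous_cosTransform _ (by omega)).aestronglyMeasurable
    (Filter.Eventually.of_forall fun t => ?_)
  rw [← div_eq_mul_inv, le_div_iff₀ (by positivity), Real.norm_eq_abs]
  linarith [abs_cosTransform_le (k + 3) (by omega) t, sq_mul_abs_cosTransform_le k t]

theorem cosTransform_abs (m : ℕ) (t : ℝ) : cosTransform m |t| = cosTransform m t := by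
  rcases abs_choice t with h | h <;> simp [h, cosTransform]

open FourierTransform in
theorem fourier_sqrt_one_sub_sq (m : ℕ) (hm : m ≠ 0) (w : ℝ) :
    𝓕 (fun s : ℝ => ((√(1 - s ^ 2) ^ m : ℝ) : ℂ)) w = (cosTransform m (π * w) : ℂ) := by
  have hcs : HasCompactSupport fun s : ℝ => √(1 - s ^ 2) ^ m :=
    HasCompactSupport.intro isCompact_Icc fun s hs => by
      rw [sqrt_one_sub_sq_eq_zero hs, zero_pow hm]
  have hcos : Integrable fun s : ℝ => cos (2 * s * (π * w)) * √(1 - s ^ 2) ^ m :=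
    Continuous.integrable_of_hasCompactSupport (by fun_prop) hcs.mul_left
  have hsin : Integrable fun s : ℝ => sin (2 * s * (π * w)) * √(1 - s ^ 2) ^ m :=
    Continuous.integrable_of_hasCompactSupport (by fun_prop) hcs.mul_left
  have hodd : ∫ s : ℝ, sin (2 * s * (π * w)) * √(1 - s ^ 2) ^ m = 0 := by
    have h := integral_neg_eq_self (fun s : ℝ => sin (2 * s * (π * w)) * √(1 - s ^ 2) ^ m) volume
    simp only [mul_neg, neg_mul, sin_neg, even_two, Even.neg_pow, integral_neg] at h
    linarith
  have hpoint (s : ℝ) : Complex.exp (↑(-2 * π * s * w) * Complex.I) •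
      ((√(1 - s ^ 2) ^ m : ℝ) : ℂ) =
      ((cos (2 * s * (π * w)) * √(1 - s ^ 2) ^ m : ℝ) : ℂ) -
        ((sin (2 * s * (π * w)) * √(1 - s ^ 2) ^ m : ℝ) : ℂ) * Complex.I := by
    rw [Complex.exp_mul_I, ← Complex.ofReal_cos, ← Complex.ofReal_sin,
      show -2 * π * s * w = -(2 * s * (π * w)) by ring, cos_neg, sin_neg, smul_eq_mul]
    push_cast
    ring
  rw [Real.fourier_real_eq_integral_exp_smul]
  simp only [hpoint]
  rw [integral_sub hcos.ofReal (hsin.ofReal.mul_const _), integral_mul_const,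
    integral_complex_ofReal, integral_complex_ofReal, hodd, cosTransform]
  simp

open FourierTransform in
/-- Fourier inversion at the origin for `s ↦ (1 - s²)₊^(m/2)`. -/
theorem integral_cosTransform (k : ℕ) : ∫ t, cosTransform (k + 3) t = π := by
  set f : ℝ → ℂ := fun s => ((√(1 - s ^ 2) ^ (k + 3) : ℝ) : ℂ) with hf
  have hF : 𝓕 f = fun w => ((cosTransform (k + 3) (π * w) : ℝ) : ℂ) :=
    funext (fourier_sqrt_one_sub_sq (k + 3) (by omega))
  have hfc : Continuous f := by fun_prop
  have hfi : Integrable f := by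
    refine hfc.integrable_of_hasCompactSupport (HasCompactSupport.intro
      (isCompact_Icc (a := -1) (b := 1)) fun s hs => ?_)
    simp only [hf, sqrt_one_sub_sq_eq_zero hs]
    simp
  have hFi : Integrable (𝓕 f) := by
    rw [hF]
    exact ((integrable_cosTransform k).comp_mul_left' pi_ne_zero).ofReal
  have hinv : 𝓕⁻ (𝓕 f) 0 = f 0 := hfi.fourierInv_fourier_eq hFi hfc.continuousAt
  rw [Real.fourierInv_eq', hF] at hinv
  simp only [inner_zero_right, mul_zero, Complex.ofReal_zero, zero_mul, Complex.exp_zero,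
    one_smul, integral_complex_ofReal, hf] at hinv
  rw [Complex.ofReal_inj, Measure.integral_comp_mul_left, abs_of_pos (by positivity)] at hinv
  simp only [ne_eq, OfNat.ofNat_ne_zero, not_false_eq_true, zero_pow, sub_zero, sqrt_one,
    one_pow, smul_eq_mul] at hinv
  rwa [inv_mul_eq_one₀ pi_ne_zero, eq_comm] at hinv

theorem integral_Ioi_cosTransform (k : ℕ) :
    ∫ t in Ioi (0 : ℝ), cosTransform (k + 3) t = π / 2 := by
  have h := integral_comp_abs (f := cosTransform (k + 3))
  simp only [cosTransform_abs, integral_cosTransform] at h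
  linarith

/-- the iterated integral ∫₀^∞ ∫_{ℝ^d} cos(2ξ_d t)(1-|ξ|²)_+ dξ dt
converges and equals π ω_{d-1}/(d+1); equivalently
(2π)^{-d} ∫₀^∞ ∫_{ℝ^d} cos(2ξ_d t)(|ξ|²-1)_- dξ dt = L_{d-1}/4. -/
theorem cos_iterated_integral
    (d : ℕ) (hd : 2 ≤ d) :
    IntegrableOn
      (fun t : ℝ => ∫ ξ : Euc d, Real.cos (2 * lastCoord ξ * t) * max (1 - ‖ξ‖^2) 0)
      (Set.Ioi 0) ∧
    (∫ t in Set.Ioi (0:ℝ),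
        ∫ ξ : Euc d, Real.cos (2 * lastCoord ξ * t) * max (1 - ‖ξ‖^2) 0)
      = π * ballVol (d-1) / (d+1) ∧
    ((2 * π) ^ d)⁻¹ * (∫ t in Set.Ioi (0:ℝ),
        ∫ ξ : Euc d, Real.cos (2 * lastCoord ξ * t) * max (1 - ‖ξ‖^2) 0)
      = Lconst (d-1) / 4 := by
  obtain ⟨k, rfl⟩ : ∃ k, d = k + 1 + 1 := ⟨d - 2, by omega⟩
  have hfun : (fun t : ℝ => ∫ ξ : Euc (k + 1 + 1),
      Real.cos (2 * lastCoord ξ * t) * max (1 - ‖ξ‖^2) 0) =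
      fun t => (2 * ballVol (k + 1) / ((k + 1 : ℕ) + 2)) * cosTransform (k + 3) t :=
    funext (integral_cos_lastCoord (k + 1) (by omega))
  have hval : ∫ t in Set.Ioi (0:ℝ), ∫ ξ : Euc (k + 1 + 1),
      Real.cos (2 * lastCoord ξ * t) * max (1 - ‖ξ‖^2) 0 =
      π * ballVol (k + 1 + 1 - 1) / ((k + 1 + 1 : ℕ) + 1) := by
    rw [hfun, integral_const_mul, integral_Ioi_cosTransform, Nat.add_sub_cancel]
    push_cast
    field_simp
    ring
  refine ⟨?_, hval, ?_⟩
  · rw [hfun]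
    exact ((integrable_cosTransform k).const_mul _).integrableOn
  · rw [hval, Lconst, Nat.add_sub_cancel]
    push_cast
    field_simp
    ring
end
end

section
/- Let Ω ⊂ ℝ^d be a bounded open set and suppose there exists a constant C₀ such that |{u ∈ ℝ^d : dist(u, ∂Ω) ≤ t}| ≤ C₀ t for all 0 < t ≤ 1. Fix 0 < l₀ ≤ 1, set d(u) = inf{|x−u| : x ∉ Ω}, l(u) = (1/2)(1 + (d(u)² + l₀²)^{−1/2})^{−1}, B_u the ball of center u and radius l(u), U₁ = {u ∈ Ω : B_u ∩ ∂Ω = ∅} and U₂ = {u ∈ ℝ^d : B_u ∩ ∂Ω ≠ ∅}. Then ∫_{U₁} l(u)^{−2} du ≤ C l₀^{−1}, and for every a ∈ ℝ, ∫_{U₂} l(u)^a du ≤ C_a l₀^{a+1}, with constants depending only on d, Ω, C₀ (and a). -/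
open MeasureTheory Real Metric Set

noncomputable section

section LengthScale

variable {d : ℕ} {Ω : Set (Euc d)} {l₀ : ℝ}

lemma distOut_nonneg (Ω : Set (Euc d)) (u : Euc d) : 0 ≤ distOut Ω u :=
  Metric.infDist_nonneg

lemma continuous_distOut (Ω : Set (Euc d)) : Continuous (distOut Ω) :=
  Metric.continuous_infDist_pt _

lemma infDist_frontier_le_distOut {u : Euc d} (hu : u ∈ Ω) :
    Metric.infDist u (frontier Ω) ≤ distOut Ω u := by
  by_cases h : Ω = univ
  · simp [h, distOut]
  · obtain ⟨y, hy, hd⟩ := exists_mem_frontier_infDist_compl_eq_dist hu h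
    exact (Metric.infDist_le_dist_of_mem hy).trans_eq hd.symm

lemma distOut_lt_of_ball_inter_frontier (hΩ : IsOpen Ω) {u : Euc d} {r : ℝ}
    (h : (Metric.ball u r ∩ frontier Ω).Nonempty) : distOut Ω u < r := by
  obtain ⟨y, hy, hyf⟩ := h
  have hyc : y ∈ Ωᶜ := fun hyΩ => (hΩ.frontier_eq ▸ hyf).2 hyΩ
  exact (Metric.infDist_le_dist_of_mem hyc).trans_lt (Metric.mem_ball'.1 hy)

lemma le_sqrt_distOut (u : Euc d) :
    l₀ ≤ √((distOut Ω u) ^ 2 + l₀ ^ 2) :=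
  Real.le_sqrt_of_sq_le (by nlinarith [sq_nonneg (distOut Ω u)])

lemma lfun_eq (hl : 0 < l₀) (u : Euc d) :
    lfun Ω l₀ u = √((distOut Ω u) ^ 2 + l₀ ^ 2) / (2 * (1 + √((distOut Ω u) ^ 2 + l₀ ^ 2))) := by
  have := hl.trans_le (le_sqrt_distOut (Ω := Ω) (l₀ := l₀) u)
  unfold lfun
  field_simp
  ring

lemma min_sqrt_div_four_le_lfun (hl : 0 < l₀) (u : Euc d) :
    min (√((distOut Ω u) ^ 2 + l₀ ^ 2)) 1 / 4 ≤ lfun Ω l₀ u := by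
  rw [lfun_eq hl]
  have := hl.trans_le (le_sqrt_distOut (Ω := Ω) (l₀ := l₀) u)
  set s := √((distOut Ω u) ^ 2 + l₀ ^ 2)
  rw [div_le_div_iff₀ (by norm_num) (by positivity)]
  rcases le_total s 1 with h | h
  · rw [min_eq_left h]; nlinarith
  · rw [min_eq_right h]; nlinarith

lemma div_four_le_lfun (hl : 0 < l₀) (hl1 : l₀ ≤ 1) (u : Euc d) : l₀ / 4 ≤ lfun Ω l₀ u := by
  have h := le_min (le_sqrt_distOut (Ω := Ω) (l₀ := l₀) u) hl1
  linarith [min_sqrt_div_four_le_lfun (Ω := Ω) hl u]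

lemma lfun_le_sqrt_div_two (hl : 0 < l₀) (u : Euc d) :
    lfun Ω l₀ u ≤ √((distOut Ω u) ^ 2 + l₀ ^ 2) / 2 := by
  rw [lfun_eq hl]
  have := hl.trans_le (le_sqrt_distOut (Ω := Ω) (l₀ := l₀) u)
  set s := √((distOut Ω u) ^ 2 + l₀ ^ 2)
  rw [div_le_div_iff₀ (by positivity) (by norm_num)]
  nlinarith

lemma lfun_le_of_distOut_lt (hl : 0 < l₀) {u : Euc d} (h : distOut Ω u < lfun Ω l₀ u) :
    lfun Ω l₀ u ≤ l₀ := by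
  have hs := lfun_le_sqrt_div_two (Ω := Ω) hl u
  have hd := distOut_nonneg Ω u
  have hsq := Real.sq_sqrt (by positivity : 0 ≤ (distOut Ω u) ^ 2 + l₀ ^ 2)
  nlinarith

/-- The inverse square of the length scale is bounded by a dyadic step function of `distOut`. -/
lemma inv_lfun_sq_le_dyadic (hl : 0 < l₀) {N : ℕ} (hN : (1 / 2 : ℝ) ^ (N + 1) < l₀) (u : Euc d) :
    ((lfun Ω l₀ u) ^ 2)⁻¹ ≤ 16 + ∑ k ∈ Finset.range (N + 1),
      {v | distOut Ω v ≤ (1 / 2 : ℝ) ^ k}.indicator (fun _ => 64 * (4 : ℝ) ^ k) u := by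
  have hls := le_sqrt_distOut (Ω := Ω) (l₀ := l₀) u
  have hds : distOut Ω u ≤ √((distOut Ω u) ^ 2 + l₀ ^ 2) :=
    Real.le_sqrt_of_sq_le (by nlinarith)
  have hm := min_sqrt_div_four_le_lfun (Ω := Ω) hl u
  set s := √((distOut Ω u) ^ 2 + l₀ ^ 2)
  have hs : 0 < s := hl.trans_le hls
  have hnn : ∀ k ∈ Finset.range (N + 1),
      0 ≤ {v | distOut Ω v ≤ (1 / 2 : ℝ) ^ k}.indicator (fun _ => 64 * (4 : ℝ) ^ k) u :=
    fun k _ => indicator_nonneg (fun _ _ => by positivity) _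
  rcases le_total s 1 with h | h
  · rw [min_eq_left h] at hm
    obtain ⟨k, hk1, hk2⟩ := exists_nat_pow_near_of_lt_one hs h
      (by norm_num : (0 : ℝ) < 1 / 2) (by norm_num)
    have hkN : k < N + 1 := (pow_lt_pow_iff_right_of_lt_one₀ (by norm_num) (by norm_num)).1
      ((hN.trans_le hls).trans_le hk2)
    have hterm := Finset.single_le_sum hnn (Finset.mem_range.2 hkN)
    rw [indicator_of_mem (show u ∈ {v | distOut Ω v ≤ (1 / 2 : ℝ) ^ k} from hds.trans hk2)]
      at hterm
    have hinv : ((lfun Ω l₀ u) ^ 2)⁻¹ ≤ 64 * (4 : ℝ) ^ k := by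
      have h1 : ((1 / 2 : ℝ) ^ (k + 1) / 4) ^ 2 ≤ (lfun Ω l₀ u) ^ 2 :=
        pow_le_pow_left₀ (by positivity) (by linarith) 2
      refine (inv_anti₀ (by positivity) h1).trans ?_
      rw [div_pow, ← pow_mul, mul_comm (k + 1) 2, pow_mul, pow_succ, inv_div,
        div_le_iff₀ (by positivity)]
      have h4 : (4 : ℝ) ^ k * ((1 / 2) ^ 2) ^ k = 1 := by rw [← mul_pow]; norm_num
      linarith
    linarith
  · rw [min_eq_right h] at hm
    have h1 : (1 / 4 : ℝ) ^ 2 ≤ (lfun Ω l₀ u) ^ 2 := pow_le_pow_left₀ (by norm_num) hm 2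
    have h2 := inv_anti₀ (by norm_num) h1
    have h3 := Finset.sum_nonneg hnn
    norm_num at h2
    linarith

end LengthScale

section IntegralBounds

variable {d : ℕ} {Ω : Set (Euc d)} {C₀ l₀ : ℝ}

lemma setIntegral_inv_lfun_sq_le (hΩb : Bornology.IsBounded Ω) (hC₀ : 0 < C₀)
    (hnbhd : ∀ t : ℝ, 0 < t → t ≤ 1 →
      volume {u : Euc d | Metric.infDist u (frontier Ω) ≤ t} ≤ ENNReal.ofReal (C₀ * t))
    (hl : 0 < l₀) (hl1 : l₀ ≤ 1) {U : Set (Euc d)} (hU : U ⊆ Ω) :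
    ∫ u in U, ((lfun Ω l₀ u) ^ 2)⁻¹ ≤ (16 * volume.real Ω + 128 * C₀) * l₀⁻¹ := by
  obtain ⟨N, hN1, hN2⟩ := exists_nat_pow_near_of_lt_one hl hl1
    (by norm_num : (0 : ℝ) < 1 / 2) (by norm_num)
  have hΩfin : volume Ω ≠ ⊤ := hΩb.measure_lt_top.ne
  have : IsFiniteMeasure (volume.restrict U) :=
    ⟨by simpa using (measure_mono hU).trans_lt hΩfin.lt_top⟩
  have hmeas (k : ℕ) : MeasurableSet {v | distOut Ω v ≤ (1 / 2 : ℝ) ^ k} :=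
    (isClosed_le (continuous_distOut Ω) continuous_const).measurableSet
  have hint (k : ℕ) : Integrable ({v | distOut Ω v ≤ (1 / 2 : ℝ) ^ k}.indicator
      (fun _ => 64 * (4 : ℝ) ^ k)) (volume.restrict U) :=
    (integrable_const _).indicator (hmeas k)
  have hvol (k : ℕ) : (volume.restrict U).real {v | distOut Ω v ≤ (1 / 2 : ℝ) ^ k} ≤
      C₀ * (1 / 2) ^ k := by
    rw [measureReal_def, Measure.restrict_apply (hmeas k)]
    refine ENNReal.toReal_le_of_le_ofReal (by positivity) ?_
    refine (measure_mono ?_).trans (hnbhd ((1 / 2) ^ k) (by positivity)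
      (pow_le_one₀ (by norm_num) (by norm_num)))
    exact fun v hv => (infDist_frontier_le_distOut (hU hv.2)).trans hv.1
  have hpow : (2 : ℝ) ^ N ≤ l₀⁻¹ := by
    rw [le_inv_comm₀ (by positivity) hl]
    simpa using hN2
  calc ∫ u in U, ((lfun Ω l₀ u) ^ 2)⁻¹
      ≤ ∫ u in U, (16 + ∑ k ∈ Finset.range (N + 1),
          {v | distOut Ω v ≤ (1 / 2 : ℝ) ^ k}.indicator (fun _ => 64 * (4 : ℝ) ^ k) u) :=
        integral_mono_of_nonneg (ae_of_all _ fun u => by positivity)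
          ((integrable_const _).add (integrable_finsetSum _ fun k _ => hint k))
          (ae_of_all _ (inv_lfun_sq_le_dyadic hl hN1))
    _ = volume.real U * 16 + ∑ k ∈ Finset.range (N + 1),
          (volume.restrict U).real {v | distOut Ω v ≤ (1 / 2 : ℝ) ^ k} * (64 * 4 ^ k) := by
        rw [integral_add (integrable_const _) (integrable_finsetSum _ fun k _ => hint k),
          integral_finsetSum _ fun k _ => hint k]
        simp [integral_indicator_const, hmeas, -one_div]
    _ ≤ volume.real Ω * 16 + ∑ k ∈ Finset.range (N + 1), 64 * C₀ * 2 ^ k := by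
        refine add_le_add (by gcongr) (Finset.sum_le_sum fun k _ => ?_)
        refine (mul_le_mul_of_nonneg_right (hvol k) (by positivity)).trans_eq ?_
        rw [show (4 : ℝ) = 2 * 2 by norm_num, mul_pow, one_div, inv_pow]
        field_simp
    _ ≤ volume.real Ω * 16 + 128 * C₀ * 2 ^ N := by
        rw [← Finset.mul_sum, geom_sum_eq (by norm_num), pow_succ]
        nlinarith
    _ ≤ (16 * volume.real Ω + 128 * C₀) * l₀⁻¹ := by
        have h1 : 1 ≤ l₀⁻¹ := (one_le_inv₀ hl).2 hl1
        have h2 := mul_le_mul_of_nonneg_left h1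
          (by positivity : 0 ≤ 16 * volume.real Ω)
        have h3 := mul_le_mul_of_nonneg_left hpow (by positivity : 0 ≤ 128 * C₀)
        linarith

lemma setIntegral_lfun_rpow_le (hΩo : IsOpen Ω) (hC₀ : 0 < C₀)
    (hnbhd : ∀ t : ℝ, 0 < t → t ≤ 1 →
      volume {u : Euc d | Metric.infDist u (frontier Ω) ≤ t} ≤ ENNReal.ofReal (C₀ * t))
    (hl : 0 < l₀) (hl1 : l₀ ≤ 1) (a : ℝ) :
    ∫ u in {u : Euc d | (Metric.ball u (lfun Ω l₀ u) ∩ frontier Ω).Nonempty},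
      (lfun Ω l₀ u) ^ a ≤ (1 + (1 / 4) ^ a) * C₀ * l₀ ^ (a + 1) := by
  set U := {u : Euc d | (Metric.ball u (lfun Ω l₀ u) ∩ frontier Ω).Nonempty}
  have hle : ∀ u ∈ U, lfun Ω l₀ u ≤ l₀ := fun u hu =>
    lfun_le_of_distOut_lt hl (distOut_lt_of_ball_inter_frontier hΩo hu)
  have hsub : U ⊆ {u | Metric.infDist u (frontier Ω) ≤ l₀} := by
    intro u hu
    obtain ⟨y, hy, hyf⟩ := id hu
    exact (Metric.infDist_le_dist_of_mem hyf).trans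
      ((Metric.mem_ball'.1 hy).le.trans (hle u hu))
  have hUle : volume U ≤ ENNReal.ofReal (C₀ * l₀) := (measure_mono hsub).trans (hnbhd l₀ hl hl1)
  have hbound : ∀ u ∈ U, ‖(lfun Ω l₀ u) ^ a‖ ≤ (1 + (1 / 4) ^ a) * l₀ ^ a := by
    intro u hu
    have hlow := div_four_le_lfun (Ω := Ω) hl hl1 u
    have hpos : 0 < lfun Ω l₀ u := by linarith
    have hq : (l₀ / 4) ^ a = (1 / 4) ^ a * l₀ ^ a := by
      rw [← Real.mul_rpow (by norm_num) hl.le]; congr 1; ring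
    have h1 : 0 < l₀ ^ a := by positivity
    have h2 : 0 < (1 / 4 : ℝ) ^ a * l₀ ^ a := by positivity
    rw [Real.norm_of_nonneg (by positivity)]
    rcases le_total 0 a with ha | ha
    · linarith [Real.rpow_le_rpow hpos.le (hle u hu) ha]
    · linarith [Real.rpow_le_rpow_of_nonpos (by positivity) hlow ha]
  calc ∫ u in U, (lfun Ω l₀ u) ^ a
      ≤ (1 + (1 / 4) ^ a) * l₀ ^ a * volume.real U := (Real.le_norm_self _).trans
        (norm_setIntegral_le_of_norm_le_const (hUle.trans_lt ENNReal.ofReal_lt_top) hbound)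
    _ ≤ (1 + (1 / 4) ^ a) * l₀ ^ a * (C₀ * l₀) := by
        gcongr
        exact ENNReal.toReal_le_of_le_ofReal (by positivity) hUle
    _ = (1 + (1 / 4) ^ a) * C₀ * l₀ ^ (a + 1) := by
        rw [Real.rpow_add_one hl.ne']; ring

end IntegralBounds

/-- integral bounds for the length scale.  If the measure of the
t-neighbourhood of ∂Ω is ≤ C₀ t for 0 < t ≤ 1, then ∫_{U₁} l(u)^{-2} du ≤ C l₀⁻¹
and ∫_{U₂} l(u)^a du ≤ C_a l₀^{a+1}, with constants independent of l₀. -/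
theorem lfun_integral_bounds
    (d : ℕ) (hd : 1 ≤ d) (Ω : Set (Euc d)) (hΩo : IsOpen Ω)
    (hΩb : Bornology.IsBounded Ω) (C₀ : ℝ) (hC₀ : 0 < C₀)
    (hnbhd : ∀ t : ℝ, 0 < t → t ≤ 1 →
      volume {u : Euc d | Metric.infDist u (frontier Ω) ≤ t} ≤ ENNReal.ofReal (C₀ * t)) :
    ∃ C : ℝ, 0 < C ∧ ∀ a : ℝ, ∃ Ca : ℝ, 0 < Ca ∧
      ∀ l₀ : ℝ, 0 < l₀ → l₀ ≤ 1 →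
        (∫ u in {u ∈ Ω | Metric.ball u (lfun Ω l₀ u) ∩ frontier Ω = ∅},
            ((lfun Ω l₀ u)^2)⁻¹) ≤ C * l₀⁻¹ ∧
        (∫ u in {u : Euc d | (Metric.ball u (lfun Ω l₀ u) ∩ frontier Ω).Nonempty},
            (lfun Ω l₀ u) ^ a) ≤ Ca * l₀ ^ (a + 1) := by
  refine ⟨16 * volume.real Ω + 128 * C₀, by positivity, fun a =>
    ⟨(1 + (1 / 4) ^ a) * C₀, by positivity, fun l₀ hl hl1 => ⟨?_, ?_⟩⟩⟩
  · exact setIntegral_inv_lfun_sq_le hΩb hC₀ hnbhd hl hl1 fun u hu => hu.1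
  · exact setIntegral_lfun_rpow_le hΩo hC₀ hnbhd hl hl1 a
end
end

section
/- Let d ≥ 2, h > 0, and let φ ∈ C₀^∞(ℝ^d) be real. Then Tr(φ H⁺ φ)_− ≤ (2πh)^{−d} ∫_{ℝ^d_+} φ(x)² ∫_{ℝ^d} 2 sin²(ξ_d x_d / h) (|ξ|² − 1)_− dξ dx, where the right-hand side equals Tr(φ (H⁺)_− φ), the trace against φ² of the negative part of H⁺, whose integral kernel is (2/(2πh)^d) ∫_{|ξ|<1} e^{iξ′·(x′−y′)/h} sin(ξ_d x_d/h) sin(ξ_d y_d/h) (1−|ξ|²) dξ. -/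
open MeasureTheory Real Metric Set

noncomputable section

/-- The open upper half-space ℝ^d_+ = {y : y_d > 0}. -/
def upperHalf (d : ℕ) : Set (Euc d) := {y : Euc d | 0 < lastCoord y}

section HalfSpace

open FourierTransform SchwartzMap LineDeriv
open scoped InnerProductSpace

variable {E : Type*} [NormedAddCommGroup E] [InnerProductSpace ℝ E]
  {e : E} {w : E → ℝ}

/-- The complexification of a smooth compactly supported real function, as a Schwartz function. -/
def complexSchwartz {W : E → ℝ} (hW : ContDiff ℝ (⊤ : ℕ∞) W) (hc : HasCompactSupport W) :
    𝓢(E, ℂ) :=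
  HasCompactSupport.toSchwartzMap (f := fun x => (W x : ℂ))
    (hc.comp_left (g := fun r : ℝ => (r : ℂ)) Complex.ofReal_zero)
    (Complex.ofRealCLM.contDiff.comp hW)

theorem complexSchwartz_apply {W : E → ℝ} (hW : ContDiff ℝ (⊤ : ℕ∞) W)
    (hc : HasCompactSupport W) (x : E) : complexSchwartz hW hc x = W x := rfl

theorem cos_sub_sq_add_sin_sub_sq (a b : ℝ) :
    (Real.cos a - Real.cos b) ^ 2 + (Real.sin a - Real.sin b) ^ 2
      = 4 * Real.sin ((a - b) / 2) ^ 2 := by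
  have h1 := Real.cos_sub a b
  have h2 := Real.cos_two_mul ((a - b) / 2)
  rw [mul_div_cancel₀ _ two_ne_zero] at h2
  nlinarith [Real.sin_sq_add_cos_sq a, Real.sin_sq_add_cos_sq b,
    Real.sin_sq_add_cos_sq ((a - b) / 2)]

/-- The reflection in the hyperplane orthogonal to `e`. -/
def mirror (e : E) : E ≃ₗᵢ[ℝ] E := (ℝ ∙ e)ᗮ.reflection

theorem mirror_apply {e : E} (he : ‖e‖ = 1) (x : E) : mirror e x = x - (2 * ⟪e, x⟫_ℝ) • e := by
  rw [mirror, Submodule.reflection_orthogonal_apply, Submodule.reflection_singleton_apply]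
  simp [he, two_smul, two_mul, add_smul]

theorem mirror_mirror (e x : E) : mirror e (mirror e x) = x :=
  Submodule.reflection_reflection _ x

theorem inner_mirror {e : E} (he : ‖e‖ = 1) (x : E) : ⟪e, mirror e x⟫_ℝ = -⟪e, x⟫_ℝ := by
  rw [mirror_apply he, inner_sub_right, inner_smul_right, real_inner_self_eq_norm_sq, he]
  ring

/-- The odd extension across the hyperplane orthogonal to `e`. -/
def oddExt (e : E) (w : E → ℝ) (x : E) : ℝ := w x - w (mirror e x)

theorem contDiff_oddExt (hw : ContDiff ℝ (⊤ : ℕ∞) w) : ContDiff ℝ (⊤ : ℕ∞) (oddExt e w) :=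
  hw.sub (hw.comp (mirror e).contDiff)

theorem hasCompactSupport_oddExt (hc : HasCompactSupport w) :
    HasCompactSupport (oddExt e w) :=
  hc.sub (hc.comp_homeomorph (mirror e).toHomeomorph)

theorem tsupport_comp_mirror : tsupport (fun x => w (mirror e x)) = mirror e ⁻¹' tsupport w :=
  tsupport_comp_eq_preimage w (mirror e).toHomeomorph

theorem disjoint_tsupport_mirror (he : ‖e‖ = 1) (hs : tsupport w ⊆ {x | 0 < ⟪e, x⟫_ℝ}) :
    Disjoint (tsupport w) (tsupport fun x => w (mirror e x)) := by
  rw [tsupport_comp_mirror, Set.disjoint_left]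
  intro x h1 h2
  have h1 := hs h1
  have h2 := hs h2
  simp only [mem_ofPred_eq, inner_mirror he] at h1 h2
  linarith

variable [FiniteDimensional ℝ E]

theorem norm_gradient (f : E → ℝ) (x : E) : ‖gradient f x‖ = ‖fderiv ℝ f x‖ := by
  simp [gradient]

theorem sum_inner_sq (x : E) :
    ∑ i, ⟪stdOrthonormalBasis ℝ E i, x⟫_ℝ ^ 2 = ‖x‖ ^ 2 := by
  simpa [Real.norm_eq_abs, sq_abs] using (stdOrthonormalBasis ℝ E).sum_sq_norm_inner_right x

theorem lineDeriv_complexSchwartz {W : E → ℝ} (hW : ContDiff ℝ (⊤ : ℕ∞) W)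
    (hc : HasCompactSupport W) (m x : E) :
    ‖(∂_{m} (complexSchwartz hW hc)) x‖ ^ 2 = ⟪m, gradient W x⟫_ℝ ^ 2 := by
  have hd : DifferentiableAt ℝ W x := (hW.differentiable (by simp)) x
  have h1 : HasFDerivAt (fun y => (W y : ℂ)) (Complex.ofRealCLM.comp (fderiv ℝ W x)) x :=
    Complex.ofRealCLM.hasFDerivAt.comp x hd.hasFDerivAt
  rw [SchwartzMap.lineDerivOp_apply_eq_fderiv]
  change ‖fderiv ℝ (fun y => (W y : ℂ)) x m‖ ^ 2 = _
  rw [h1.fderiv, real_inner_comm, gradient, InnerProductSpace.toDual_symm_apply]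
  simp

theorem norm_gradient_sub_sq {a b : E → ℝ} (hab : Disjoint (tsupport a) (tsupport b)) (x : E) :
    ‖gradient (fun y => a y - b y) x‖ ^ 2 = ‖gradient a x‖ ^ 2 + ‖gradient b x‖ ^ 2 := by
  simp only [norm_gradient]
  by_cases hx : x ∈ tsupport a
  · have hb := notMem_tsupport_iff_eventuallyEq.1 (Set.disjoint_left.1 hab hx)
    have h1 : (fun y => a y - b y) =ᶠ[nhds x] a := by
      filter_upwards [hb] with y hy
      simp [hy]
    rw [h1.fderiv_eq, hb.fderiv_eq]
    simp
  · have ha := notMem_tsupport_iff_eventuallyEq.1 hx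
    have h1 : (fun y => a y - b y) =ᶠ[nhds x] fun y => -b y := by
      filter_upwards [ha] with y hy
      simp [hy]
    rw [h1.fderiv_eq, ha.fderiv_eq, fderiv_fun_neg]
    simp

theorem hasCompactSupport_max_one_sub_norm_sq {c : ℝ} (hc : 0 < c) :
    HasCompactSupport fun k : E => max (1 - ‖c • k‖ ^ 2) 0 := by
  refine HasCompactSupport.intro (isCompact_closedBall (0 : E) c⁻¹) fun k hk => ?_
  rw [mem_closedBall_zero_iff, not_le, inv_lt_iff_one_lt_mul₀ hc] at hk
  have : 1 < ‖c • k‖ := by rwa [norm_smul, Real.norm_eq_abs, abs_of_pos hc, mul_comm]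
  exact max_eq_right (by nlinarith)

variable [MeasurableSpace E] [BorelSpace E]

/-- The Fourier transform of a real-valued function. -/
def realFourier (W : E → ℝ) : E → ℂ := 𝓕 (fun x => (W x : ℂ))

theorem realFourier_eq_integral (W : E → ℝ) (k : E) :
    realFourier W k = ∫ x, (W x : ℂ) * Complex.exp (((-(2 * π * ⟪x, k⟫_ℝ) : ℝ) : ℂ) * Complex.I) := by
  rw [realFourier, Real.fourier_eq']
  refine integral_congr_ae (Filter.Eventually.of_forall fun x => ?_)
  simp only [smul_eq_mul]
  rw [mul_comm]
  congr 3
  push_cast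
  ring

theorem fourier_complexSchwartz {W : E → ℝ} (hW : ContDiff ℝ (⊤ : ℕ∞) W)
    (hc : HasCompactSupport W) (k : E) : 𝓕 (complexSchwartz hW hc) k = realFourier W k := by
  rw [SchwartzMap.fourier_coe]; rfl

theorem integral_sq_eq_fourier {W : E → ℝ} (hW : ContDiff ℝ (⊤ : ℕ∞) W)
    (hc : HasCompactSupport W) : ∫ x, (W x) ^ 2 = ∫ k, ‖realFourier W k‖ ^ 2 := by
  have := SchwartzMap.integral_norm_sq_fourier (complexSchwartz hW hc)
  simp only [fourier_complexSchwartz, complexSchwartz_apply, Complex.norm_real,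
    Real.norm_eq_abs, sq_abs] at this
  exact this.symm

theorem fourier_lineDeriv_complexSchwartz {W : E → ℝ} (hW : ContDiff ℝ (⊤ : ℕ∞) W)
    (hc : HasCompactSupport W) (m k : E) :
    ‖𝓕 (∂_{m} (complexSchwartz hW hc)) k‖ ^ 2
      = (2 * π) ^ 2 * (⟪m, k⟫_ℝ ^ 2 * ‖realFourier W k‖ ^ 2) := by
  have hg : (fun x : E => ⟪x, m⟫_ℝ).HasTemperateGrowth :=
    ((innerSL ℝ).flip m).hasTemperateGrowth
  rw [SchwartzMap.fourier_lineDerivOp_eq]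
  simp only [smul_apply, SchwartzMap.smulLeftCLM_apply_apply hg,
    fourier_complexSchwartz]
  rw [norm_smul, norm_smul, real_inner_comm]
  simp only [norm_mul, Complex.norm_I, Complex.norm_real, Real.norm_eq_abs, Complex.norm_ofNat,
    mul_one, mul_pow, sq_abs]

theorem integrable_norm_sq (f : 𝓢(E, ℂ)) : Integrable fun x => ‖f x‖ ^ 2 := by
  exact (f.memLp 2 volume).integrable_norm_pow (by norm_num)

theorem integrable_realFourier_sq {W : E → ℝ} (hW : ContDiff ℝ (⊤ : ℕ∞) W)
    (hc : HasCompactSupport W) : Integrable fun k => ‖realFourier W k‖ ^ 2 := by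
  simpa only [fourier_complexSchwartz] using integrable_norm_sq (𝓕 (complexSchwartz hW hc))

theorem integrable_sq_mul_realFourier_sq {W : E → ℝ} (hW : ContDiff ℝ (⊤ : ℕ∞) W)
    (hc : HasCompactSupport W) :
    Integrable fun k => (2 * π) ^ 2 * (‖k‖ ^ 2 * ‖realFourier W k‖ ^ 2) := by
  have := integrable_finsetSum Finset.univ fun i _ =>
    integrable_norm_sq (𝓕 (∂_{stdOrthonormalBasis ℝ E i} (complexSchwartz hW hc)))
  simpa only [fourier_lineDeriv_complexSchwartz, ← Finset.mul_sum, ← Finset.sum_mul,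
    sum_inner_sq] using this

theorem integral_gradient_sq_eq_fourier {W : E → ℝ} (hW : ContDiff ℝ (⊤ : ℕ∞) W)
    (hc : HasCompactSupport W) :
    ∫ x, ‖gradient W x‖ ^ 2 = ∫ k, (2 * π) ^ 2 * (‖k‖ ^ 2 * ‖realFourier W k‖ ^ 2) := by
  have h1 := integral_finsetSum Finset.univ fun i _ =>
    integrable_norm_sq (𝓕 (∂_{stdOrthonormalBasis ℝ E i} (complexSchwartz hW hc)))
  have h2 := integral_finsetSum Finset.univ fun i _ =>
    integrable_norm_sq (∂_{stdOrthonormalBasis ℝ E i} (complexSchwartz hW hc))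
  simp only [SchwartzMap.integral_norm_sq_fourier] at h1
  rw [← h2] at h1
  simpa only [fourier_lineDeriv_complexSchwartz, lineDeriv_complexSchwartz, ← Finset.mul_sum,
    ← Finset.sum_mul, sum_inner_sq] using h1.symm

theorem energy_le_fourier {W : E → ℝ} (hW : ContDiff ℝ (⊤ : ℕ∞) W)
    (hc : HasCompactSupport W) (h : ℝ) :
    (∫ x, (W x) ^ 2) - h ^ 2 * ∫ x, ‖gradient W x‖ ^ 2
      ≤ ∫ k, max (1 - ‖(2 * π * h) • k‖ ^ 2) 0 * ‖realFourier W k‖ ^ 2 := by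
  have i1 := integrable_realFourier_sq hW hc
  have i2 := integrable_sq_mul_realFourier_sq hW hc
  rw [integral_sq_eq_fourier hW hc, integral_gradient_sq_eq_fourier hW hc, ← integral_const_mul,
    ← integral_sub i1 (i2.const_mul _)]
  refine integral_mono (i1.sub (i2.const_mul _)) ?_ fun k => ?_
  · refine i1.bdd_mul (c := 1) (by fun_prop) (Filter.Eventually.of_forall fun k => ?_)
    rw [Real.norm_eq_abs, abs_of_nonneg (le_max_right _ _)]
    exact max_le (by nlinarith [sq_nonneg ‖(2 * π * h) • k‖]) zero_le_one
  · have : ‖(2 * π * h) • k‖ ^ 2 = h ^ 2 * ((2 * π) ^ 2 * ‖k‖ ^ 2) := by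
      rw [norm_smul, mul_pow, Real.norm_eq_abs, sq_abs]; ring
    have hm := mul_le_mul_of_nonneg_right (le_max_left (1 - ‖(2 * π * h) • k‖ ^ 2) 0)
      (sq_nonneg ‖realFourier W k‖)
    rw [this] at hm ⊢
    refine le_trans (le_of_eq ?_) hm
    simp only
    ring

theorem sum_integral_mul_sq_le {α : Type*} [MeasurableSpace α] {μ : Measure α} {n : ℕ}
    {v : Fin n → α → ℝ} {f : α → ℝ} (hv : ∀ i, MemLp (v i) 2 μ) (hf : MemLp f 2 μ)
    (ho : ∀ i j, (∫ x, v i x * v j x ∂μ) = if i = j then (1 : ℝ) else 0) :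
    ∑ i, (∫ x, v i x * f x ∂μ) ^ 2 ≤ ∫ x, (f x) ^ 2 ∂μ := by
  have key : ∀ {a b : α → ℝ} (ha : MemLp a 2 μ) (hb : MemLp b 2 μ),
      ⟪ha.toLp a, hb.toLp b⟫_ℝ = ∫ x, a x * b x ∂μ := by
    intro a b ha hb
    rw [MeasureTheory.L2.inner_def]
    refine integral_congr_ae ?_
    filter_upwards [ha.coeFn_toLp, hb.coeFn_toLp] with x h1 h2
    rw [h1, h2]
    simp [mul_comm]
  have on : Orthonormal ℝ fun i => (hv i).toLp (v i) := by
    rw [orthonormal_iff_ite]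
    intro i j
    rw [key, ho]
  have := on.sum_inner_products_le (hf.toLp f) (s := Finset.univ)
  rw [← real_inner_self_eq_norm_sq, key] at this
  simpa only [key, Real.norm_eq_abs, sq_abs, ← pow_two] using this

theorem norm_sq_integral_mul_exp_sub {w a b : E → ℝ}
    (hw : Continuous w) (hc : HasCompactSupport w) (ha : Continuous a) (hb : Continuous b) :
    ‖∫ x, (w x : ℂ) * (Complex.exp ((a x : ℝ) * Complex.I) - Complex.exp ((b x : ℝ) * Complex.I))‖ ^ 2
      = (∫ x, w x * (Real.cos (a x) - Real.cos (b x))) ^ 2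
        + (∫ x, w x * (Real.sin (a x) - Real.sin (b x))) ^ 2 := by
  have hi : Integrable fun x => (w x : ℂ) *
      (Complex.exp ((a x : ℝ) * Complex.I) - Complex.exp ((b x : ℝ) * Complex.I)) := by
    refine Continuous.integrable_of_hasCompactSupport (by fun_prop) ?_
    exact (hc.comp_left (g := fun r : ℝ => (r : ℂ)) Complex.ofReal_zero).mul_right
  rw [← Complex.normSq_eq_norm_sq, Complex.normSq_apply, ← pow_two, ← pow_two]
  have hre := integral_re (𝕜 := ℂ) hi
  have him := integral_im (𝕜 := ℂ) hi
  simp only [RCLike.re_to_complex, RCLike.im_to_complex] at hre him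
  rw [← hre, ← him]
  simp only [Complex.re_ofReal_mul, Complex.im_ofReal_mul, Complex.sub_re, Complex.sub_im,
    Complex.exp_ofReal_mul_I_re, Complex.exp_ofReal_mul_I_im]

theorem integral_comp_mirror {F : Type*} [NormedAddCommGroup F] [NormedSpace ℝ F] (e : E)
    (f : E → F) : ∫ x, f (mirror e x) = ∫ x, f x :=
  (mirror e).measurePreserving.integral_comp (mirror e).toHomeomorph.measurableEmbedding f

theorem integrable_comp_mirror {F : Type*} [NormedAddCommGroup F] (e : E) {f : E → F}
    (hf : Integrable f) : Integrable fun x => f (mirror e x) :=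
  ((mirror e).measurePreserving.integrable_comp_emb
    (mirror e).toHomeomorph.measurableEmbedding).2 hf

theorem integral_oddExt_sq (he : ‖e‖ = 1) (hw : ContDiff ℝ (⊤ : ℕ∞) w)
    (hc : HasCompactSupport w) (hs : tsupport w ⊆ {x | 0 < ⟪e, x⟫_ℝ}) :
    ∫ x, (oddExt e w x) ^ 2 = 2 * ∫ x, (w x) ^ 2 := by
  have hd := disjoint_tsupport_mirror he hs
  have h1 : ∀ x, (oddExt e w x) ^ 2 = (w x) ^ 2 + (w (mirror e x)) ^ 2 := by
    intro x
    have : w x * w (mirror e x) = 0 := by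
      by_cases hx : x ∈ tsupport w
      · have h0 : w (mirror e x) = 0 :=
          image_eq_zero_of_notMem_tsupport (f := fun y => w (mirror e y))
            (Set.disjoint_left.1 hd hx)
        rw [h0, mul_zero]
      · rw [image_eq_zero_of_notMem_tsupport hx, zero_mul]
    rw [oddExt]
    linear_combination (-2) * this
  have i1 : Integrable fun x => (w x) ^ 2 :=
    (hw.continuous.memLp_of_hasCompactSupport hc).integrable_sq
  have i2 := integrable_comp_mirror e i1
  simp only [h1]
  rw [integral_add i1 i2, integral_comp_mirror e fun x => (w x) ^ 2]
  ring

theorem integral_gradient_oddExt_sq (he : ‖e‖ = 1) (hw : ContDiff ℝ (⊤ : ℕ∞) w)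
    (hc : HasCompactSupport w) (hs : tsupport w ⊆ {x | 0 < ⟪e, x⟫_ℝ}) :
    ∫ x, ‖gradient (oddExt e w) x‖ ^ 2 = 2 * ∫ x, ‖gradient w x‖ ^ 2 := by
  have h2 : ∀ x, ‖gradient (fun y => w (mirror e y)) x‖ = ‖gradient w (mirror e x)‖ := by
    intro x
    rw [norm_gradient, norm_gradient]
    have := (mirror e).toContinuousLinearEquiv.comp_right_fderiv (f := w) (x := x)
    change fderiv ℝ (fun y => w (mirror e y)) x = _ at this
    rw [this]
    exact ContinuousLinearMap.opNorm_comp_linearIsometryEquiv _ (mirror e)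
  have h1 : ∀ x, ‖gradient (oddExt e w) x‖ ^ 2
      = ‖gradient w x‖ ^ 2 + ‖gradient w (mirror e x)‖ ^ 2 := by
    intro x
    rw [← h2 x]
    exact norm_gradient_sub_sq (disjoint_tsupport_mirror he hs) x
  have i1 : Integrable fun x => ‖gradient w x‖ ^ 2 := by
    simp only [norm_gradient]
    refine Continuous.integrable_of_hasCompactSupport
      ((hw.continuous_fderiv (by simp)).norm.pow 2) ?_
    exact (hc.fderiv ℝ).comp_left (g := fun L => ‖L‖ ^ 2) (by simp)
  have i2 := integrable_comp_mirror e i1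
  simp only [h1]
  rw [integral_add i1 i2, integral_comp_mirror e fun x => ‖gradient w x‖ ^ 2]
  ring

theorem realFourier_oddExt (hw : Continuous w) (hc : HasCompactSupport w) (k : E) :
    realFourier (oddExt e w) k = ∫ x, (w x : ℂ) *
      (Complex.exp (((-(2 * π * ⟪x, k⟫_ℝ) : ℝ) : ℂ) * Complex.I)
        - Complex.exp (((-(2 * π * ⟪mirror e x, k⟫_ℝ) : ℝ) : ℂ) * Complex.I)) := by
  have hcc : HasCompactSupport fun x => (w x : ℂ) :=
    hc.comp_left (g := fun r : ℝ => (r : ℂ)) Complex.ofReal_zero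
  have i1 : Integrable fun x => (w x : ℂ) *
      Complex.exp (((-(2 * π * ⟪x, k⟫_ℝ) : ℝ) : ℂ) * Complex.I) :=
    Continuous.integrable_of_hasCompactSupport (by fun_prop) hcc.mul_right
  have i2 : Integrable fun x => (w x : ℂ) *
      Complex.exp (((-(2 * π * ⟪mirror e x, k⟫_ℝ) : ℝ) : ℂ) * Complex.I) := by
    refine Continuous.integrable_of_hasCompactSupport ?_ hcc.mul_right
    have := (mirror e).continuous
    fun_prop
  have i3 := integrable_comp_mirror e i2
  have e3 := integral_comp_mirror e fun x => (w x : ℂ) *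
      Complex.exp (((-(2 * π * ⟪mirror e x, k⟫_ℝ) : ℝ) : ℂ) * Complex.I)
  simp only [mirror_mirror] at i3 e3
  simp only [mul_sub]
  rw [realFourier_eq_integral, integral_sub i1 i2, ← e3, ← integral_sub i1 i3]
  simp only [oddExt, Complex.ofReal_sub, sub_mul]

theorem setIntegral_eq_of_tsupport_subset {v g : E → ℝ} {U : Set E} (hs : tsupport v ⊆ U) :
    ∫ x in U, v x * g x = ∫ x, v x * g x :=
  setIntegral_eq_integral_of_forall_compl_eq_zero fun x hx => by
    rw [image_eq_zero_of_notMem_tsupport fun h => hx (hs h), zero_mul]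

theorem sum_norm_sq_realFourier_oddExt_le {e : E} (he : ‖e‖ = 1) {φ : E → ℝ}
    (hφ : ContDiff ℝ (⊤ : ℕ∞) φ) (hφc : HasCompactSupport φ) {n : ℕ} {v : Fin n → E → ℝ}
    (hv : ∀ i, ContDiff ℝ (⊤ : ℕ∞) (v i)) (hvc : ∀ i, HasCompactSupport (v i))
    (hvs : ∀ i, tsupport (v i) ⊆ {x | 0 < ⟪e, x⟫_ℝ})
    (ho : ∀ i j, (∫ x, v i x * v j x) = if i = j then (1 : ℝ) else 0) (k : E) :
    ∑ i, ‖realFourier (oddExt e fun x => φ x * v i x) k‖ ^ 2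
      ≤ ∫ x in {x | 0 < ⟪e, x⟫_ℝ},
          4 * ((φ x) ^ 2 * Real.sin (2 * π * (⟪e, k⟫_ℝ * ⟪e, x⟫_ℝ)) ^ 2) := by
  have hR := (mirror e).continuous
  have hφ0 := hφ.continuous
  let a : E → ℝ := fun x => -(2 * π * ⟪x, k⟫_ℝ)
  let b : E → ℝ := fun x => -(2 * π * ⟪mirror e x, k⟫_ℝ)
  have ha : Continuous a := by fun_prop
  have hb : Continuous b := by fun_prop
  have hm : ∀ {f : E → ℝ}, Continuous f → HasCompactSupport f →
      MemLp f 2 (volume.restrict {x | 0 < ⟪e, x⟫_ℝ}) :=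
    fun h1 h2 => (h1.memLp_of_hasCompactSupport h2).restrict _
  have hfc : MemLp (fun x => φ x * (Real.cos (a x) - Real.cos (b x))) 2
      (volume.restrict {x | 0 < ⟪e, x⟫_ℝ}) := hm (by fun_prop) hφc.mul_right
  have hfs : MemLp (fun x => φ x * (Real.sin (a x) - Real.sin (b x))) 2
      (volume.restrict {x | 0 < ⟪e, x⟫_ℝ}) := hm (by fun_prop) hφc.mul_right
  have hvm := fun i => hm (hv i).continuous (hvc i)
  have ho' : ∀ i j, (∫ x in {x | 0 < ⟪e, x⟫_ℝ}, v i x * v j x)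
      = if i = j then (1 : ℝ) else 0 := fun i j => by
    rw [setIntegral_eq_of_tsupport_subset (hvs i), ho]
  have hc := sum_integral_mul_sq_le hvm hfc ho'
  have hs := sum_integral_mul_sq_le hvm hfs ho'
  have hi : ∀ i, ‖realFourier (oddExt e fun x => φ x * v i x) k‖ ^ 2
      = (∫ x in {x | 0 < ⟪e, x⟫_ℝ}, v i x * (φ x * (Real.cos (a x) - Real.cos (b x)))) ^ 2
        + (∫ x in {x | 0 < ⟪e, x⟫_ℝ}, v i x * (φ x * (Real.sin (a x) - Real.sin (b x)))) ^ 2 := by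
    intro i
    have hw : Continuous fun x => φ x * v i x := hφ0.mul (hv i).continuous
    rw [realFourier_oddExt hw hφc.mul_right,
      norm_sq_integral_mul_exp_sub hw hφc.mul_right ha hb,
      setIntegral_eq_of_tsupport_subset (hvs i), setIntegral_eq_of_tsupport_subset (hvs i)]
    congr 3 <;> · ext x; ring
  simp only [hi, Finset.sum_add_distrib]
  refine (add_le_add hc hs).trans_eq ?_
  rw [← integral_add hfc.integrable_sq hfs.integrable_sq]
  refine integral_congr_ae (Filter.Eventually.of_forall fun x => ?_)
  have hab : Real.sin ((a x - b x) / 2) ^ 2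
      = Real.sin (2 * π * (⟪e, k⟫_ℝ * ⟪e, x⟫_ℝ)) ^ 2 := by
    have : (a x - b x) / 2 = -(2 * π * (⟪e, k⟫_ℝ * ⟪e, x⟫_ℝ)) := by
      simp only [a, b, mirror_apply he, inner_sub_left, inner_smul_left]
      simp
      ring
    rw [this, Real.sin_neg, neg_sq]
  have := cos_sub_sq_add_sin_sub_sq (a x) (b x)
  rw [hab] at this
  simp only
  linear_combination (φ x) ^ 2 * this

theorem sum_energy_le {e : E} (he : ‖e‖ = 1) {h : ℝ} (hh : 0 < h) {φ : E → ℝ}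
    (hφ : ContDiff ℝ (⊤ : ℕ∞) φ) (hφc : HasCompactSupport φ) {n : ℕ} {v : Fin n → E → ℝ}
    (hv : ∀ i, ContDiff ℝ (⊤ : ℕ∞) (v i)) (hvc : ∀ i, HasCompactSupport (v i))
    (hvs : ∀ i, tsupport (v i) ⊆ {x | 0 < ⟪e, x⟫_ℝ})
    (ho : ∀ i j, (∫ x, v i x * v j x) = if i = j then (1 : ℝ) else 0) :
    ∑ j, ((∫ x, (φ x) ^ 2 * (v j x) ^ 2)
          - h ^ 2 * ∫ x, ‖gradient (fun y => φ y * v j y) x‖ ^ 2)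
      ≤ ((2 * π * h) ^ Module.finrank ℝ E)⁻¹ *
          ∫ x in {x | 0 < ⟪e, x⟫_ℝ}, (φ x) ^ 2 *
            ∫ ξ : E, 2 * Real.sin (⟪e, ξ⟫_ℝ * ⟪e, x⟫_ℝ / h) ^ 2 * max (1 - ‖ξ‖ ^ 2) 0 := by
  have hφ0 := hφ.continuous
  have hpos : 0 < 2 * π * h := by positivity
  let m : E → ℝ := fun k => max (1 - ‖(2 * π * h) • k‖ ^ 2) 0
  have hm : Continuous m := by fun_prop
  have hm0 : ∀ k, 0 ≤ m k := fun k => le_max_right _ _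
  have him : Integrable m :=
    hm.integrable_of_hasCompactSupport (hasCompactSupport_max_one_sub_norm_sq hpos)
  have hm1 : ∀ k, ‖m k‖ ≤ 1 := fun k => by
    rw [Real.norm_eq_abs, abs_of_nonneg (hm0 k)]
    exact max_le (by nlinarith [sq_nonneg ‖(2 * π * h) • k‖]) zero_le_one
  have hwd : ∀ j, ContDiff ℝ (⊤ : ℕ∞) fun x => φ x * v j x := fun j => hφ.mul (hv j)
  have hwc : ∀ j, HasCompactSupport fun x => φ x * v j x := fun j => hφc.mul_right
  have hws : ∀ j, tsupport (fun x => φ x * v j x) ⊆ {x | 0 < ⟪e, x⟫_ℝ} := fun j =>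
    (tsupport_mul_subset_right).trans (hvs j)
  have hiF : ∀ j, Integrable fun k =>
      m k * ‖realFourier (oddExt e fun x => φ x * v j x) k‖ ^ 2 := fun j =>
    (integrable_realFourier_sq (contDiff_oddExt (hwd j))
      (hasCompactSupport_oddExt (hwc j))).bdd_mul (c := 1) hm.aestronglyMeasurable
      (Filter.Eventually.of_forall hm1)
  have hj : ∀ j, (∫ x, (φ x) ^ 2 * (v j x) ^ 2)
          - h ^ 2 * ∫ x, ‖gradient (fun y => φ y * v j y) x‖ ^ 2
      ≤ 2⁻¹ * ∫ k, m k * ‖realFourier (oddExt e fun x => φ x * v j x) k‖ ^ 2 := by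
    intro j
    have := energy_le_fourier (contDiff_oddExt (e := e) (hwd j))
      (hasCompactSupport_oddExt (hwc j)) h
    rw [integral_oddExt_sq he (hwd j) (hwc j) (hws j),
      integral_gradient_oddExt_sq he (hwd j) (hwc j) (hws j)] at this
    simp only [mul_pow] at this
    linarith
  have hφi : Integrable (fun x => (φ x) ^ 2) (volume.restrict {x | 0 < ⟪e, x⟫_ℝ}) :=
    ((hφ0.memLp_of_hasCompactSupport hφc).integrable_sq).restrict
  have hprod : Integrable (Function.uncurry fun (k x : E) =>
      m k * (4 * ((φ x) ^ 2 * Real.sin (2 * π * (⟪e, k⟫_ℝ * ⟪e, x⟫_ℝ)) ^ 2)))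
      (volume.prod (volume.restrict {x | 0 < ⟪e, x⟫_ℝ})) := by
    have := (him.mul_prod hφi).bdd_mul (c := 4)
      (f := fun p : E × E => 4 * Real.sin (2 * π * (⟪e, p.1⟫_ℝ * ⟪e, p.2⟫_ℝ)) ^ 2)
      (by fun_prop) (Filter.Eventually.of_forall fun p => by
        rw [Real.norm_eq_abs, abs_of_nonneg (by positivity)]
        nlinarith [Real.sin_sq_le_one (2 * π * (⟪e, p.1⟫_ℝ * ⟪e, p.2⟫_ℝ))])
    refine this.congr (Filter.Eventually.of_forall fun p => ?_)
    simp only [Function.uncurry_def]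
    ring
  calc _ ≤ ∑ j, 2⁻¹ * ∫ k, m k * ‖realFourier (oddExt e fun x => φ x * v j x) k‖ ^ 2 :=
        Finset.sum_le_sum fun j _ => hj j
    _ = 2⁻¹ * ∫ k, m k * ∑ j, ‖realFourier (oddExt e fun x => φ x * v j x) k‖ ^ 2 := by
        rw [← Finset.mul_sum, ← integral_finsetSum _ fun j _ => hiF j]
        simp only [Finset.mul_sum]
    _ ≤ 2⁻¹ * ∫ k, ∫ x in {x | 0 < ⟪e, x⟫_ℝ},
          m k * (4 * ((φ x) ^ 2 * Real.sin (2 * π * (⟪e, k⟫_ℝ * ⟪e, x⟫_ℝ)) ^ 2)) := by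
        refine mul_le_mul_of_nonneg_left (integral_mono ?_ hprod.integral_prod_left fun k => ?_)
          (by norm_num)
        · simp only [Finset.mul_sum]
          exact integrable_finsetSum _ fun j _ => hiF j
        · simp only [integral_const_mul (m k)]
          exact mul_le_mul_of_nonneg_left
            (sum_norm_sq_realFourier_oddExt_le he hφ hφc hv hvc hvs ho k) (hm0 k)
    _ = _ := by
        rw [integral_integral_swap hprod, ← integral_const_mul, ← integral_const_mul]
        refine integral_congr_ae (Filter.Eventually.of_forall fun x => ?_)
        have hsc := Measure.integral_comp_smul (volume : Measure E) (fun ξ : E =>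
          2 * Real.sin (⟪e, ξ⟫_ℝ * ⟪e, x⟫_ℝ / h) ^ 2 * max (1 - ‖ξ‖ ^ 2) 0) (2 * π * h)
        rw [abs_of_pos (by positivity), smul_eq_mul] at hsc
        simp only
        rw [mul_left_comm, ← hsc, ← integral_const_mul, ← integral_const_mul]
        refine integral_congr_ae (Filter.Eventually.of_forall fun k => ?_)
        have : ⟪e, (2 * π * h) • k⟫_ℝ * ⟪e, x⟫_ℝ / h = 2 * π * (⟪e, k⟫_ℝ * ⟪e, x⟫_ℝ) := by
          rw [inner_smul_right]
          field_simp
        simp only [this, m]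
        ring

end HalfSpace

/-- half-space Berezin-type bound via the sine transform:
Tr(φ H⁺ φ)_- ≤ (2πh)^{-d} ∫_{ℝ^d_+} φ(x)² ∫_{ℝ^d} 2 sin²(ξ_d x_d/h) (|ξ|²-1)_- dξ dx. -/
theorem half_space_berezin_bound
    (d : ℕ) (hd : 2 ≤ d) (h : ℝ) (hh : 0 < h)
    (φ : Euc d → ℝ) (hφ : ContDiff ℝ (⊤ : ℕ∞) φ) (hφc : HasCompactSupport φ) :
    trNeg (upperHalf d) h φ
      ≤ ((2 * π * h) ^ d)⁻¹ *
          ∫ x in upperHalf d, (φ x)^2 *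
            ∫ ξ : Euc d,
              2 * Real.sin (lastCoord ξ * lastCoord x / h)^2 * max (1 - ‖ξ‖^2) 0 := by
  let e : Euc d := EuclideanSpace.single ⟨d - 1, by omega⟩ 1
  have he : ‖e‖ = 1 := by simp [e]
  have hl : ∀ x : Euc d, lastCoord x = inner ℝ e x := fun x => by
    simp [lastCoord, e, EuclideanSpace.inner_single_left, show 0 < d by omega]
  have hU : upperHalf d = {x : Euc d | 0 < inner ℝ e x} := by
    simp only [upperHalf, hl]
  refine Real.sSup_le ?_ ?_
  · rintro S ⟨n, v, hv, ho, rfl⟩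
    rw [hU] at hv ⊢
    simp only [hl]
    simpa using sum_energy_le he hh hφ hφc (fun i => (hv i).1) (fun i => (hv i).2.1)
      (fun i => (hv i).2.2) ho
  · have : ∀ x, 0 ≤ (φ x) ^ 2 * ∫ ξ : Euc d,
        2 * Real.sin (lastCoord ξ * lastCoord x / h) ^ 2 * max (1 - ‖ξ‖ ^ 2) 0 := fun x =>
      mul_nonneg (sq_nonneg _) (integral_nonneg fun ξ =>
        mul_nonneg (by positivity) (le_max_right _ _))
    exact mul_nonneg (by positivity) (integral_nonneg this)
end
end
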